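/- Let k ≥ 5 be an integer. For every ε > 0 there exists a constant A > 0 such that for all real X ≥ 2, the integral ∫_0^∞ P_k(t)² e^{−t/X} dt converges and |∫_0^∞ P_k(t)² e^{−t/X} dt − (C_k − π^k/(6 Γ(k/2)²)) Γ(k−1) X^{k−1}| ≤ A X^{k−2+ε}. -/

import Mathlib

open scoped Real

/-- `rk k m` = number of ways to write `m` as a sum of `k` integer squares. -/
noncomputable def rk (k m : ℕ) : ℕ :=
  Nat.card {v : Fin k → ℤ // (∑ i, (v i) ^ 2) = (m : ℤ)}

/-- `Sk k t` = number of lattice points of `ℤ^k` in the closed ball of radius `√t`. -/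
noncomputable def Sk (k : ℕ) (t : ℝ) : ℕ :=
  Nat.card {v : Fin k → ℤ // (∑ i, ((v i : ℝ)) ^ 2) ≤ t}

/-- `Vk k` = volume of the unit ball in `ℝ^k`. -/
noncomputable def Vk (k : ℕ) : ℝ :=
  Real.pi ^ ((k : ℝ) / 2) / Real.Gamma ((k : ℝ) / 2 + 1)

/-- `Pk k t` = lattice point discrepancy of the `k`-dimensional ball of radius `√t`. -/
noncomputable def Pk (k : ℕ) (t : ℝ) : ℝ :=
  (Sk k t : ℝ) - Vk k * t ^ ((k : ℝ) / 2)

/-- Value of the (analytically continued) Riemann zeta function at a real point. -/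
noncomputable def rzeta (x : ℝ) : ℝ := (riemannZeta (x : ℂ)).re

/-- The Riemann zeta function with its 2-factor removed. -/
noncomputable def rzeta2 (x : ℝ) : ℝ := (1 - (2 : ℝ) ^ (-x)) * rzeta x

/-- The constant `C_k` for `k ≥ 4`. -/
noncomputable def Ck (k : ℕ) : ℝ :=
  ((k : ℝ) ^ 2 / 24) * (Vk k) ^ 2 +
    Real.pi ^ (k : ℝ) * rzeta ((k : ℝ) - 2) * (1 + (2 : ℝ) ^ ((3 : ℝ) - (k : ℝ))) /
      (12 * (Real.Gamma ((k : ℝ) / 2)) ^ 2 * rzeta2 (k : ℝ))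

namespace LatticeDiscrepancy
open MeasureTheory FourierTransform SchwartzMap
open scoped ContDiff

/-- The `L²`-Fourier transform of an integrable, square integrable function is given by the
Fourier integral. -/
theorem fourier_toLp_ae_eq {f : ℝ → ℂ} (hf : Integrable f) (hf2 : MemLp f 2) :
    (𝓕 (hf2.toLp f) : Lp ℂ 2 (volume : Measure ℝ)) =ᵐ[volume] 𝓕 f := by
  have hcont : Continuous (𝓕 f) :=
    VectorFourier.fourierIntegral_continuous Real.continuous_fourierChar
      (by exact continuous_inner) hf
  refine ae_eq_of_integral_contDiff_smul_eq
    ((Lp.memLp _).locallyIntegrable (by norm_num)) hcont.locallyIntegrable fun g hg hgs => ?_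
  have hgs' : HasCompactSupport (fun x => (g x : ℂ)) :=
    hgs.comp_left (g := fun x : ℝ => (x : ℂ)) (by simp)
  have hg' : ContDiff ℝ ∞ (fun x => (g x : ℂ)) :=
    Complex.ofRealCLM.contDiff.comp hg
  set φ : 𝓢(ℝ, ℂ) := hgs'.toSchwartzMap hg' with hφ
  have h1 := Lp.fourier_toTemperedDistribution_eq (hf2.toLp f)
  have h2 := congrArg (fun T : 𝓢'(ℝ, ℂ) => T φ) h1
  simp only [TemperedDistribution.fourier_apply, Lp.toTemperedDistribution_apply] at h2
  have h3 : ∫ x, (𝓕 φ) x • (hf2.toLp f : ℝ → ℂ) x = ∫ x, (𝓕 φ) x • f x := by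
    refine integral_congr_ae ?_
    filter_upwards [hf2.coeFn_toLp] with x hx
    rw [hx]
  have h4 := VectorFourier.integral_fourierIntegral_smul_eq_flip (μ := volume) (ν := volume)
    (L := innerₗ ℝ) (f := (φ : ℝ → ℂ)) (g := f) Real.continuous_fourierChar
    (by exact continuous_inner) φ.integrable hf
  have hφg : ∀ x, φ x = g x := fun x => rfl
  calc ∫ x, g x • (𝓕 (hf2.toLp f) : Lp ℂ 2 (volume : Measure ℝ)) x
      = ∫ x, φ x • (𝓕 (hf2.toLp f) : Lp ℂ 2 (volume : Measure ℝ)) x := by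
        simp only [hφg, Complex.real_smul, smul_eq_mul]
    _ = ∫ x, (𝓕 φ) x • f x := by rw [← h2, h3]
    _ = ∫ x, φ x • 𝓕 f x := by
        rw [SchwartzMap.fourier_coe]
        have hflip : (innerₗ ℝ).flip = innerₗ ℝ := by
          ext; simp
        rw [hflip] at h4
        exact h4
    _ = ∫ x, g x • 𝓕 f x := by
        simp only [hφg, Complex.real_smul, smul_eq_mul]

/-- Plancherel's theorem for integrable, square integrable functions. -/
theorem integral_norm_sq_fourier {f : ℝ → ℂ} (hf : Integrable f) (hf2 : MemLp f 2) :
    Integrable (fun x => ‖𝓕 f x‖ ^ 2) ∧ ∫ x, ‖𝓕 f x‖ ^ 2 = ∫ x, ‖f x‖ ^ 2 := by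
  have hae := fourier_toLp_ae_eq hf hf2
  have hmem : MemLp (𝓕 f) 2 := (memLp_congr_ae hae).1 (Lp.memLp _)
  have hsq : ∀ g : Lp ℂ 2 (volume : Measure ℝ), ‖g‖ ^ 2 = ∫ x, ‖g x‖ ^ 2 := by
    intro g
    have h := L2.inner_def (𝕜 := ℂ) g g
    rw [inner_self_eq_norm_sq_to_K] at h
    have h' : ∫ x, inner ℂ (g x) (g x) = ((∫ x, ‖g x‖ ^ 2 : ℝ) : ℂ) := by
      rw [← integral_complex_ofReal]
      simp
    rw [h'] at h
    refine Complex.ofReal_injective ?_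
    rw [← h]
    simp
  refine ⟨hmem.integrable_norm_pow (by norm_num), ?_⟩
  have h1 := hsq (𝓕 (hf2.toLp f))
  have h2 := hsq (hf2.toLp f)
  rw [Lp.norm_fourier_eq, h2] at h1
  calc ∫ x, ‖𝓕 f x‖ ^ 2
      = ∫ x, ‖(𝓕 (hf2.toLp f) : Lp ℂ 2 (volume : Measure ℝ)) x‖ ^ 2 := by
        refine integral_congr_ae ?_
        filter_upwards [hae] with x hx
        rw [hx]
    _ = ∫ x, ‖(hf2.toLp f : ℝ → ℂ) x‖ ^ 2 := h1.symm
    _ = ∫ x, ‖f x‖ ^ 2 := by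
        refine integral_congr_ae ?_
        filter_upwards [hf2.coeFn_toLp] with x hx
        rw [hx]

end LatticeDiscrepancy

namespace LatticeDiscrepancy
open MeasureTheory FourierTransform Set

/-- The Laplace transform of a power function. -/
theorem integral_rpow_mul_cexp {a : ℝ} (ha : 0 < a) {s : ℂ} (hs : 0 < s.re) :
    IntegrableOn (fun t : ℝ => ((t ^ (a - 1) : ℝ) : ℂ) * Complex.exp (-s * t)) (Ioi 0) ∧
    ∫ t in Ioi (0 : ℝ), ((t ^ (a - 1) : ℝ) : ℂ) * Complex.exp (-s * t)
      = Real.Gamma a * (1 / s) ^ (a : ℂ) := by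
  have hnorm : ∀ (b : ℝ) (s : ℂ) (t : ℝ), 0 < t →
      ‖((t ^ b : ℝ) : ℂ) * Complex.exp (-s * t)‖ = t ^ b * Real.exp (-s.re * t) := by
    intro b s t ht
    rw [norm_mul, Complex.norm_real, Real.norm_of_nonneg (by positivity), Complex.norm_exp]
    simp
  have hmeas : ∀ (b : ℝ) (s : ℂ), AEStronglyMeasurable
      (fun t : ℝ => ((t ^ b : ℝ) : ℂ) * Complex.exp (-s * t)) (volume.restrict (Ioi 0)) := by
    intro b s
    apply Measurable.aestronglyMeasurable
    fun_prop
  have hreal : ∀ (b r : ℝ), -1 < b → 0 < r →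
      IntegrableOn (fun t : ℝ => t ^ b * Real.exp (-r * t)) (Ioi 0) := by
    intro b r hb hr
    simpa using integrableOn_rpow_mul_exp_neg_mul_rpow (p := 1) hb one_pos hr
  have hint : ∀ (b : ℝ) (s : ℂ), -1 < b → 0 < s.re → IntegrableOn
      (fun t : ℝ => ((t ^ b : ℝ) : ℂ) * Complex.exp (-s * t)) (Ioi 0) := by
    intro b s hb hs
    refine (hreal b s.re hb hs).mono' (hmeas b s) ?_
    filter_upwards [self_mem_ae_restrict measurableSet_Ioi] with t ht
    exact (hnorm b s t ht).le
  refine ⟨hint _ _ (by linarith) hs, ?_⟩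
  set H : ℂ → ℂ := fun s => ∫ t in Ioi (0 : ℝ), ((t ^ (a - 1) : ℝ) : ℂ) * Complex.exp (-s * t)
    with hH
  set G : ℂ → ℂ := fun s => Real.Gamma a * (1 / s) ^ (a : ℂ) with hG
  have hopen : IsOpen {s : ℂ | 0 < s.re} := isOpen_lt continuous_const Complex.continuous_re
  have hHd : DifferentiableOn ℂ H {s : ℂ | 0 < s.re} := by
    intro s₀ hs₀
    have hs₀' : 0 < s₀.re := hs₀
    refine DifferentiableAt.differentiableWithinAt ?_
    refine (hasDerivAt_integral_of_dominated_loc_of_deriv_le (s := Metric.ball s₀ (s₀.re / 2))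
      (F' := fun s t => ((t ^ (a - 1) : ℝ) : ℂ) * (Complex.exp (-s * t) * (-t)))
      (bound := fun t => t ^ a * Real.exp (-(s₀.re / 2) * t))
      (Metric.ball_mem_nhds _ (by positivity)) (.of_forall fun s => hmeas _ s)
      (hint _ _ (by linarith) hs₀) ?_ ?_ (hreal _ _ (by linarith) (by positivity))
        ?_).2.differentiableAt
    · apply Measurable.aestronglyMeasurable
      fun_prop
    · filter_upwards [self_mem_ae_restrict measurableSet_Ioi] with t ht s hs
      have ht' : (0 : ℝ) < t := ht
      have hre : s₀.re / 2 ≤ s.re := by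
        have h1 := Complex.abs_re_le_norm (s - s₀)
        rw [Metric.mem_ball, dist_eq_norm] at hs
        rw [Complex.sub_re] at h1
        have := (abs_le.1 (h1.trans hs.le)).1
        linarith
      rw [← mul_assoc, norm_mul, hnorm _ _ _ ht', norm_neg, Complex.norm_real,
        Real.norm_of_nonneg ht'.le, mul_right_comm]
      have : t ^ (a - 1) * t = t ^ a := by
        rw [← Real.rpow_add_one ht'.ne']; ring_nf
      rw [this]
      gcongr
    · filter_upwards with t s hs
      refine HasDerivAt.const_mul _ ?_
      have h1 : HasDerivAt (fun s : ℂ => -s * t) (-t) s := by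
        simpa using (hasDerivAt_id s).neg.mul_const (t : ℂ)
      exact h1.cexp
  have hGd : DifferentiableOn ℂ G {s : ℂ | 0 < s.re} := by
    intro s hs
    have hs' : 0 < s.re := hs
    have hs0 : s ≠ 0 := by rintro rfl; simp at hs'
    refine DifferentiableAt.differentiableWithinAt ?_
    refine DifferentiableAt.const_mul ?_ _
    refine DifferentiableAt.cpow (by fun_prop (disch := assumption)) (by fun_prop) ?_
    left
    rw [one_div, Complex.inv_re]
    exact div_pos hs' (Complex.normSq_pos.2 hs0)
  have hconn : IsPreconnected {s : ℂ | 0 < s.re} :=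
    (convex_halfSpace_re_gt 0).isPreconnected
  have hfreq : ∃ᶠ z in nhdsWithin (1 : ℂ) {1}ᶜ, H z = G z := by
    have hpos : ∀ r : ℝ, 0 < r → H r = G r := by
      intro r hr
      have h := Complex.integral_cpow_mul_exp_neg_mul_Ioi (a := a) (r := r) (by simpa using ha) hr
      simp only [hH, hG]
      rw [← Complex.Gamma_ofReal, mul_comm, ← h]
      refine setIntegral_congr_fun measurableSet_Ioi fun t ht => ?_
      have ht' : (0 : ℝ) < t := ht
      rw [Complex.ofReal_cpow ht'.le]
      push_cast
      ring_nf
    have htend : Filter.Tendsto (fun n : ℕ => ((1 + 1 / ((n : ℝ) + 1) : ℝ) : ℂ)) Filter.atTop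
        (nhdsWithin (1 : ℂ) {1}ᶜ) := by
      refine tendsto_nhdsWithin_iff.2 ⟨?_, .of_forall fun n => ?_⟩
      · have h := (tendsto_one_div_add_atTop_nhds_zero_nat (𝕜 := ℝ)).const_add 1
        have h' := (Complex.continuous_ofReal.tendsto _).comp h
        simpa [Function.comp_def] using h'
      · have : (0 : ℝ) < 1 / ((n : ℝ) + 1) := by positivity
        simp only [mem_compl_iff, mem_singleton_iff]
        intro h
        have h2 : (1 + 1 / ((n : ℝ) + 1) : ℝ) = 1 := by exact_mod_cast h
        linarith
    refine htend.frequently (Filter.Frequently.of_forall fun n => ?_)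
    exact hpos _ (by positivity)
  have := (hHd.analyticOnNhd hopen).eqOn_of_preconnected_of_frequently_eq
    (hGd.analyticOnNhd hopen) hconn (z₀ := 1) (by simp) hfreq
  exact this hs
end LatticeDiscrepancy

namespace LatticeDiscrepancy
open MeasureTheory FourierTransform Set

/-- The theta series `∑ exp (-s n²)` over the integers. -/
noncomputable def theta (s : ℂ) : ℂ := ∑' n : ℤ, Complex.exp (-s * (n : ℂ) ^ 2)

theorem summable_theta {s : ℂ} (hs : 0 < s.re) :
    Summable fun n : ℤ => Complex.exp (-s * (n : ℂ) ^ 2) := by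
  have h := (summable_jacobiTheta₂_term_iff 0 (Complex.I * s / π)).2 (by
    rw [mul_div_assoc, Complex.I_mul_im, Complex.div_ofReal_re]; positivity)
  refine h.congr fun n => ?_
  rw [jacobiTheta₂_term]
  congr 1
  have : (π : ℂ) ≠ 0 := by exact_mod_cast Real.pi_ne_zero
  field_simp
  linear_combination ((n : ℂ) ^ 2 * s) * Complex.I_sq

/-- A power of an absolutely convergent series, expanded as a series over tuples. -/
theorem hasSum_pi_prod {ι : Type*} {f : ι → ℂ} {S : ℂ} (hf : Summable fun i => ‖f i‖)
    (hS : HasSum f S) (k : ℕ) :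
    HasSum (fun v : Fin k → ι => ∏ i, f (v i)) (S ^ k) ∧
      Summable fun v : Fin k → ι => ‖∏ i, f (v i)‖ := by
  induction k with
  | zero =>
    have : Unique (Fin 0 → ι) := Pi.uniqueOfIsEmpty _
    refine ⟨?_, (hasSum_unique _).summable⟩
    simp
  | succ k ih =>
    let e : ι × (Fin k → ι) ≃ (Fin (k + 1) → ι) := Fin.consEquiv fun _ => ι
    have he : ∀ p : ι × (Fin k → ι), ∏ i, f (e p i) = f p.1 * ∏ i, f (p.2 i) := by
      intro p
      rw [Fin.prod_univ_succ]
      rfl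
    have h1 := ih.1
    have h2 := ih.2
    set g : (Fin k → ι) → ℂ := fun v => ∏ i, f (v i)
    have h3 : HasSum (fun p : ι × (Fin k → ι) => f p.1 * g p.2) (S * S ^ k) :=
      hS.mul h1 (summable_mul_of_summable_norm hf h2)
    constructor
    · rw [← e.hasSum_iff, pow_succ']
      refine h3.congr_fun ?_
      exact fun p => he p
    · rw [← e.summable_iff]
      refine (hf.mul_norm h2).congr fun p => ?_
      exact congrArg norm (he p).symm

/-- The squared Euclidean length of an integer vector. -/
def sqLen {k : ℕ} (v : Fin k → ℤ) : ℝ := ∑ i, ((v i : ℝ)) ^ 2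

theorem sqLen_nonneg {k : ℕ} (v : Fin k → ℤ) : 0 ≤ sqLen v :=
  Finset.sum_nonneg fun _ _ => sq_nonneg _

theorem hasSum_exp_sqLen (k : ℕ) {s : ℂ} (hs : 0 < s.re) :
    HasSum (fun v : Fin k → ℤ => Complex.exp (-s * sqLen v)) (theta s ^ k) := by
  convert! (hasSum_pi_prod (summable_theta hs).norm (summable_theta hs).hasSum k).1 using 2 with v
  rw [← Complex.exp_sum, sqLen]
  congr 1
  push_cast
  rw [Finset.mul_sum]

theorem summable_exp_sqLen (k : ℕ) {η : ℝ} (hη : 0 < η) :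
    Summable (fun v : Fin k → ℤ => Real.exp (-η * sqLen v)) := by
  have h := (hasSum_exp_sqLen k (s := η) (by simpa using hη)).summable.norm
  refine h.congr fun v => ?_
  rw [Complex.norm_exp]
  simp

theorem finite_sqLen_le (k : ℕ) (t : ℝ) : {v : Fin k → ℤ | sqLen v ≤ t}.Finite := by
  have h := (summable_exp_sqLen k one_pos).tendsto_cofinite_zero
  have h2 := h.eventually (gt_mem_nhds (Real.exp_pos (-t)))
  rw [Filter.eventually_cofinite] at h2
  refine h2.subset fun v hv => ?_
  simp only [mem_ofPred_eq, not_lt] at hv ⊢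
  gcongr
  linarith

theorem hasSum_Sk (k : ℕ) (t : ℝ) :
    HasSum (fun v : Fin k → ℤ => if sqLen v ≤ t then (1 : ℝ) else 0) (Sk k t) := by
  have hfin := finite_sqLen_le k t
  have h := hasSum_sum_of_ne_finset_zero (L := SummationFilter.unconditional _)
    (f := fun v : Fin k → ℤ => if sqLen v ≤ t then (1 : ℝ) else 0)
    (s := hfin.toFinset) (by intro v hv; simpa using hv)
  convert! h using 1
  rw [Finset.sum_congr rfl (g := fun _ => (1 : ℝ)) (by intro v hv; simpa using hv)]
  rw [Finset.sum_const, nsmul_eq_mul, mul_one, ← Set.ncard_eq_toFinset_card _ hfin]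
  rfl

theorem Sk_mono (k : ℕ) : Monotone fun t => (Sk k t : ℝ) := by
  intro t u htu
  refine hasSum_le (fun v => ?_) (hasSum_Sk k t) (hasSum_Sk k u)
  split_ifs <;> linarith

theorem Sk_le_exp (k : ℕ) {η : ℝ} (hη : 0 < η) :
    ∃ C : ℝ, 0 ≤ C ∧ ∀ t, (Sk k t : ℝ) ≤ C * Real.exp (η * t) := by
  refine ⟨∑' v : Fin k → ℤ, Real.exp (-η * sqLen v), tsum_nonneg fun v => (Real.exp_pos _).le,
    fun t => ?_⟩
  refine hasSum_le (fun v => ?_) (hasSum_Sk k t)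
    ((summable_exp_sqLen k hη).hasSum.mul_right _)
  split_ifs with h
  · rw [← Real.exp_add, Real.one_le_exp_iff]
    nlinarith
  · positivity

/-- The Laplace transform of the lattice point counting function. -/
theorem integral_Sk_mul_cexp (k : ℕ) {s : ℂ} (hs : 0 < s.re) :
    ∫ t in Ioi (0 : ℝ), (Sk k t : ℂ) * Complex.exp (-s * t) = theta s ^ k / s := by
  have hs0 : s ≠ 0 := by rintro rfl; simp at hs
  set F : (Fin k → ℤ) → ℝ → ℂ := fun v => (Ici (sqLen v)).indicator
    (fun t : ℝ => Complex.exp (-s * t)) with hF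
  have hset : ∀ v : Fin k → ℤ, ((Ioi (0 : ℝ)) ∩ Ici (sqLen v) : Set ℝ) =ᵐ[volume] Ioi (sqLen v) := by
    intro v
    have h0 := sqLen_nonneg v
    have h1 : (Ioi (0 : ℝ) ∩ Ici (sqLen v) : Set ℝ) =ᵐ[volume] (Ioi 0 ∩ Ioi (sqLen v) : Set ℝ) :=
      (ae_eq_refl _).inter Ioi_ae_eq_Ici.symm
    refine h1.trans (Filter.EventuallyEq.of_eq ?_)
    rw [Ioi_inter_Ioi, max_eq_right h0]
  have hI : ∀ v, IntegrableOn (F v) (Ioi 0) := by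
    intro v
    exact (integrableOn_exp_mul_complex_Ioi (a := -s) (by simpa using hs) 0).indicator
      measurableSet_Ici
  have hint : ∀ v, ∫ t in Ioi (0 : ℝ), F v t = Complex.exp (-s * sqLen v) / s := by
    intro v
    rw [hF]
    simp only
    rw [setIntegral_indicator measurableSet_Ici, setIntegral_congr_set (hset v),
      integral_exp_mul_complex_Ioi (by simpa using hs)]
    field_simp
  have hnorm : ∀ v, ∫ t in Ioi (0 : ℝ), ‖F v t‖ = Real.exp (-s.re * sqLen v) / s.re := by
    intro v
    have : ∀ t, ‖F v t‖ = (Ici (sqLen v)).indicator (fun t : ℝ => Real.exp (-s.re * t)) t := by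
      intro t
      rw [hF]
      simp only [norm_indicator_eq_indicator_norm, Complex.norm_exp]
      simp
    simp only [this]
    rw [setIntegral_indicator measurableSet_Ici, setIntegral_congr_set (hset v),
      integral_exp_mul_Ioi (by linarith)]
    field_simp
  have hsum := hasSum_integral_of_summable_integral_norm (μ := volume.restrict (Ioi 0)) hI
    (by simp only [hnorm]; exact (summable_exp_sqLen k hs).div_const _)
  simp only [hint] at hsum
  rw [((hasSum_exp_sqLen k hs).div_const s).unique hsum]
  refine integral_congr_ae (.of_forall fun t => ?_)
  have h := (Complex.hasSum_ofReal.2 (hasSum_Sk k t)).mul_right (Complex.exp (-s * t))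
  simp only
  rw [Complex.ofReal_natCast] at h
  rw [← h.tsum_eq]
  refine tsum_congr fun v => ?_
  simp only [hF, indicator, mem_Ici]
  split_ifs <;> simp
end LatticeDiscrepancy

namespace LatticeDiscrepancy
open MeasureTheory FourierTransform Set

/-- The point `σ + 2πix` on the vertical line of abscissa `σ`. -/
noncomputable def vline (σ x : ℝ) : ℂ := σ + 2 * π * x * Complex.I

@[simp] theorem vline_re (σ x : ℝ) : (vline σ x).re = σ := by simp [vline]

@[simp] theorem vline_im (σ x : ℝ) : (vline σ x).im = 2 * π * x := by simp [vline]

/-- Plancherel's theorem for the Laplace transform on a vertical line. -/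
theorem plancherel_laplace {p : ℝ → ℝ} (hp : Measurable p) {σ : ℝ} (hσ : 0 < σ) {L : ℂ → ℂ}
    (hint : IntegrableOn (fun t : ℝ => p t ^ 2 * Real.exp (-(2 * σ) * t)) (Ioi 0))
    (hint1 : IntegrableOn (fun t : ℝ => p t * Real.exp (-σ * t)) (Ioi 0))
    (hL : ∀ s : ℂ, 0 < s.re → ∫ t in Ioi (0 : ℝ), (p t : ℂ) * Complex.exp (-s * t) = L s) :
    Integrable (fun x => ‖L (vline σ x)‖ ^ 2) ∧
      ∫ x, ‖L (vline σ x)‖ ^ 2 = ∫ t in Ioi (0 : ℝ), p t ^ 2 * Real.exp (-(2 * σ) * t) := by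
  set g : ℝ → ℂ := fun t => ((p t * Real.exp (-σ * t) : ℝ) : ℂ) with hg
  set f : ℝ → ℂ := (Ioi (0 : ℝ)).indicator g with hf
  have hgm : Measurable g := by fun_prop
  have hf1 : Integrable f := (integrable_indicator_iff measurableSet_Ioi).2 hint1.ofReal
  have hsq : ∀ t, ‖f t‖ ^ 2 =
      (Ioi (0 : ℝ)).indicator (fun t => p t ^ 2 * Real.exp (-(2 * σ) * t)) t := by
    intro t
    simp only [hf, hg, indicator]
    split_ifs
    · rw [Complex.norm_real, Real.norm_eq_abs, sq_abs, mul_pow, ← Real.exp_nat_mul]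
      congr 2
      push_cast; ring
    · simp
  have hf2 : MemLp f 2 := by
    rw [memLp_two_iff_integrable_sq_norm hf1.1]
    simp only [hsq]
    exact (integrable_indicator_iff measurableSet_Ioi).2 hint
  have hF : ∀ x, 𝓕 f x = L (vline σ x) := by
    intro x
    rw [Real.fourier_real_eq_integral_exp_smul, ← hL _ (by simpa using hσ),
      ← integral_indicator measurableSet_Ioi]
    refine integral_congr_ae (.of_forall fun t => ?_)
    simp only [hf, hg, indicator]
    split_ifs
    · rw [smul_eq_mul]
      push_cast
      rw [mul_left_comm, ← Complex.exp_add, vline]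
      congr 2
      ring
    · simp
  have h := integral_norm_sq_fourier hf1 hf2
  simp only [hF, hsq] at h
  rw [integral_indicator measurableSet_Ioi] at h
  exact h

theorem vline_norm_sq (σ x : ℝ) : ‖vline σ x‖ ^ 2 = σ ^ 2 + (2 * π * x) ^ 2 := by
  rw [← Complex.normSq_eq_norm_sq, Complex.normSq_apply, vline_re, vline_im]; ring

/-- The mean value of `‖σ + 2πix‖ ^ (-k)`. -/
theorem integral_vline_norm_pow (k : ℕ) (hk : 2 ≤ k) {σ : ℝ} (hσ : 0 < σ) :
    Integrable (fun x => (‖vline σ x‖ ^ k)⁻¹) ∧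
    ∫ x, (‖vline σ x‖ ^ k)⁻¹ =
      Real.Gamma ((k : ℝ) - 1) * (1 / (2 * σ)) ^ ((k : ℝ) - 1) / Real.Gamma ((k : ℝ) / 2) ^ 2 := by
  have hk' : (2 : ℝ) ≤ k := by exact_mod_cast hk
  have ha : (0 : ℝ) < (k : ℝ) / 2 := by positivity
  have hreal : ∀ (b r : ℝ), -1 < b → 0 < r →
      IntegrableOn (fun t : ℝ => t ^ b * Real.exp (-r * t)) (Ioi 0) := by
    intro b r hb hr
    simpa using integrableOn_rpow_mul_exp_neg_mul_rpow (p := 1) hb one_pos hr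
  have hsq : ∀ t ∈ Ioi (0 : ℝ), (t ^ ((k : ℝ) / 2 - 1)) ^ 2 * Real.exp (-(2 * σ) * t)
      = t ^ ((k : ℝ) - 1 - 1) * Real.exp (-((2 * σ) * t)) := by
    intro t ht
    have ht' : (0 : ℝ) < t := ht
    rw [← Real.rpow_natCast, ← Real.rpow_mul ht'.le, neg_mul]
    congr 2
    push_cast; ring
  have h := plancherel_laplace (p := fun t => t ^ ((k : ℝ) / 2 - 1)) (by fun_prop) hσ
    (L := fun s => Real.Gamma ((k : ℝ) / 2) * (1 / s) ^ (((k : ℝ) / 2 : ℝ) : ℂ))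
    (by
      refine (integrableOn_congr_fun hsq measurableSet_Ioi).2 ?_
      simpa using hreal ((k : ℝ) - 1 - 1) (2 * σ) (by linarith) (by positivity))
    (hreal _ _ (by linarith) hσ)
    (fun s hs => (integral_rpow_mul_cexp ha hs).2)
  have hG : 0 < Real.Gamma ((k : ℝ) / 2) := Real.Gamma_pos_of_pos ha
  have hn : ∀ x, ‖(Real.Gamma ((k : ℝ) / 2) : ℂ) * (1 / vline σ x) ^ (((k : ℝ) / 2 : ℝ) : ℂ)‖ ^ 2
      = Real.Gamma ((k : ℝ) / 2) ^ 2 * (‖vline σ x‖ ^ k)⁻¹ := by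
    intro x
    have h0 : 0 < ‖vline σ x‖ := by
      rw [norm_pos_iff]; intro h; have := vline_re σ x; rw [h] at this; simp at this; linarith
    rw [norm_mul, mul_pow, Complex.norm_real, Real.norm_of_nonneg hG.le]
    congr 1
    have : (1 / vline σ x) ≠ 0 := by
      rw [one_div]; exact inv_ne_zero (norm_pos_iff.1 h0)
    rw [Complex.norm_cpow_of_ne_zero this]
    simp only [Complex.ofReal_re, Complex.ofReal_im, mul_zero, Real.exp_zero, div_one, norm_div,
      norm_one]
    rw [← Real.rpow_natCast, ← Real.rpow_mul (by positivity)]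
    have : (k : ℝ) / 2 * ((2 : ℕ) : ℝ) = k := by push_cast; ring
    rw [this, Real.rpow_natCast, one_div, inv_pow]
  simp only [hn] at h
  have hI : Integrable (fun x => (‖vline σ x‖ ^ k)⁻¹) := by
    refine (integrable_const_mul_iff ?_ _).1 h.1
    exact (pow_pos hG 2).ne'.isUnit
  refine ⟨hI, ?_⟩
  have h2 := h.2
  rw [integral_const_mul, setIntegral_congr_fun measurableSet_Ioi hsq,
    Real.integral_rpow_mul_exp_neg_mul_Ioi (by linarith) (by positivity)] at h2
  rw [eq_div_iff (by positivity), mul_comm, h2]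
  ring

/-- The Laplace transform of the discrepancy. -/
noncomputable def disc (k : ℕ) (s : ℂ) : ℂ := (theta s ^ k - (π / s) ^ ((k : ℂ) / 2)) / s

theorem disc_mean_square (k : ℕ) (hk : 1 ≤ k) {X : ℝ} (hX : 0 < X) :
    IntegrableOn (fun t : ℝ => Pk k t ^ 2 * Real.exp (-t / X)) (Ioi 0) ∧
    Integrable (fun x => ‖disc k (vline (1 / (2 * X)) x)‖ ^ 2) ∧
      ∫ x, ‖disc k (vline (1 / (2 * X)) x)‖ ^ 2 =
        ∫ t in Ioi (0 : ℝ), Pk k t ^ 2 * Real.exp (-t / X) := by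
  set σ : ℝ := 1 / (2 * X) with hσdef
  have hσ : 0 < σ := by positivity
  have hrpow : ∀ η : ℝ, 0 < η → ∃ C : ℝ, 0 ≤ C ∧ ∀ t : ℝ, 0 < t →
      t ^ ((k : ℝ) / 2) ≤ C * Real.exp (η * t) := by
    intro η hη
    refine ⟨1 + k.factorial / η ^ k, by positivity, fun t ht => ?_⟩
    have h1 : t ^ ((k : ℝ) / 2) ≤ 1 + t ^ k := by
      rcases le_total t 1 with h | h
      · have := Real.rpow_le_one ht.le h (by positivity : (0 : ℝ) ≤ (k : ℝ) / 2)
        have := pow_pos ht k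
        linarith
      · have := Real.rpow_le_rpow_of_exponent_le h
          (by have : (0 : ℝ) ≤ k := by positivity
              linarith : (k : ℝ) / 2 ≤ k)
        rw [Real.rpow_natCast] at this
        linarith
    have h2 := Real.pow_div_factorial_le_exp (η * t) (by positivity) k
    have h3 : (1 : ℝ) ≤ Real.exp (η * t) := Real.one_le_exp (by positivity)
    have h4 : t ^ k = (k.factorial / η ^ k) * ((η * t) ^ k / k.factorial) := by
      rw [mul_pow]; field_simp
    calc t ^ ((k : ℝ) / 2) ≤ 1 + t ^ k := h1
      _ ≤ Real.exp (η * t) + (k.factorial / η ^ k) * Real.exp (η * t) := by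
          rw [h4]; gcongr
      _ = _ := by ring
  have hbound : ∃ C : ℝ, 0 ≤ C ∧ ∀ t : ℝ, 0 < t → |Pk k t| ≤ C * Real.exp (σ / 2 * t) := by
    obtain ⟨C₁, hC₁, h₁⟩ := Sk_le_exp k (half_pos hσ)
    obtain ⟨C₂, hC₂, h₂⟩ := hrpow _ (half_pos hσ)
    refine ⟨C₁ + |Vk k| * C₂, by positivity, fun t ht => ?_⟩
    rw [Pk]
    refine (abs_sub _ _).trans ?_
    rw [abs_mul, abs_of_nonneg (Nat.cast_nonneg _),
      abs_of_nonneg (by positivity : 0 ≤ t ^ ((k : ℝ) / 2)),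
      add_mul, mul_assoc]
    have := h₁ t
    have := h₂ t ht
    gcongr
  obtain ⟨C, hC, hP⟩ := hbound
  have hSm : Measurable fun t => (Sk k t : ℝ) := (Sk_mono k).measurable
  have hPm : Measurable (Pk k) := by
    unfold Pk
    fun_prop
  have hdom : ∀ c : ℝ, 0 < c → IntegrableOn (fun t : ℝ => Real.exp (-c * t)) (Ioi 0) :=
    fun c hc => integrableOn_exp_mul_Ioi (by linarith) 0
  have hint : IntegrableOn (fun t : ℝ => Pk k t ^ 2 * Real.exp (-(2 * σ) * t)) (Ioi 0) := by
    refine ((hdom σ hσ).const_mul (C ^ 2)).mono' (by fun_prop) ?_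
    filter_upwards [self_mem_ae_restrict measurableSet_Ioi] with t ht
    rw [Real.norm_of_nonneg (by positivity), ← sq_abs]
    calc |Pk k t| ^ 2 * Real.exp (-(2 * σ) * t)
        ≤ (C * Real.exp (σ / 2 * t)) ^ 2 * Real.exp (-(2 * σ) * t) := by
          gcongr; exact hP t ht
      _ = C ^ 2 * Real.exp (-σ * t) := by
          rw [mul_pow, ← Real.exp_nat_mul, mul_assoc, ← Real.exp_add]
          congr 2; push_cast; ring
  have hint1 : IntegrableOn (fun t : ℝ => Pk k t * Real.exp (-σ * t)) (Ioi 0) := by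
    refine ((hdom (σ / 2) (half_pos hσ)).const_mul C).mono' (by fun_prop) ?_
    filter_upwards [self_mem_ae_restrict measurableSet_Ioi] with t ht
    rw [norm_mul, Real.norm_of_nonneg (Real.exp_pos _).le, Real.norm_eq_abs]
    calc |Pk k t| * Real.exp (-σ * t)
        ≤ (C * Real.exp (σ / 2 * t)) * Real.exp (-σ * t) := by
          gcongr; exact hP t ht
      _ = C * Real.exp (-(σ / 2) * t) := by
          rw [mul_assoc, ← Real.exp_add]
          congr 2; ring
  have hL : ∀ s : ℂ, 0 < s.re →
      ∫ t in Ioi (0 : ℝ), (Pk k t : ℂ) * Complex.exp (-s * t) = disc k s := by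
    intro s hs
    have hs0 : s ≠ 0 := by rintro rfl; simp at hs
    have hg := integral_rpow_mul_cexp (a := (k : ℝ) / 2 + 1) (by positivity) hs
    have hS : IntegrableOn (fun t : ℝ => (Sk k t : ℂ) * Complex.exp (-s * t)) (Ioi 0) := by
      obtain ⟨C₁, hC₁, h₁⟩ := Sk_le_exp k (half_pos hs)
      refine ((hdom (s.re / 2) (half_pos hs)).const_mul C₁).mono' ?_ (.of_forall fun t => ?_)
      · have : Measurable fun t => ((Sk k t : ℝ) : ℂ) := by fun_prop
        simp only [Complex.ofReal_natCast] at this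
        exact Measurable.aestronglyMeasurable (by fun_prop)
      · rw [norm_mul, Complex.norm_natCast, Complex.norm_exp]
        have e : (-s * t : ℂ).re = -s.re * t := by simp
        rw [e]
        calc (Sk k t : ℝ) * Real.exp (-s.re * t)
            ≤ (C₁ * Real.exp (s.re / 2 * t)) * Real.exp (-s.re * t) := by
              gcongr; exact h₁ t
          _ = C₁ * Real.exp (-(s.re / 2) * t) := by
              rw [mul_assoc, ← Real.exp_add]
              congr 2; ring
    rw [add_sub_cancel_right] at hg
    have hsplit : ∀ t : ℝ, (Pk k t : ℂ) * Complex.exp (-s * t) =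
        (Sk k t : ℂ) * Complex.exp (-s * t) -
        (Vk k : ℂ) * (((t ^ ((k : ℝ) / 2) : ℝ) : ℂ) * Complex.exp (-s * t)) := by
      intro t; rw [Pk]; push_cast; ring
    simp only [hsplit]
    rw [integral_sub hS (hg.1.const_mul _), integral_Sk_mul_cexp k hs, integral_const_mul, hg.2,
      disc, sub_div]
    congr 1
    have hG : (Real.Gamma ((k : ℝ) / 2 + 1) : ℂ) ≠ 0 := by
      exact_mod_cast (Real.Gamma_pos_of_pos (by positivity)).ne'
    have e1 : (Vk k : ℂ) * Real.Gamma ((k : ℝ) / 2 + 1) = (π : ℂ) ^ ((k : ℂ) / 2) := by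
      rw [Vk, Complex.ofReal_div, div_mul_cancel₀ _ hG, Complex.ofReal_cpow Real.pi_pos.le]
      push_cast; rfl
    have e2 : (1 / s) ^ (((k : ℝ) / 2 + 1 : ℝ) : ℂ) = (1 / s) ^ ((k : ℂ) / 2) * (1 / s) := by
      push_cast
      rw [Complex.cpow_add _ _ (by simpa using hs0), Complex.cpow_one]
    have e3 : ((π : ℂ) / s) ^ ((k : ℂ) / 2) = (π : ℂ) ^ ((k : ℂ) / 2) * (1 / s) ^ ((k : ℂ) / 2) := by
      have hpi : (π : ℂ) ≠ 0 := by exact_mod_cast Real.pi_ne_zero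
      have hs1 : 1 / s ≠ 0 := by simpa using hs0
      rw [div_eq_mul_one_div, Complex.cpow_def_of_ne_zero (mul_ne_zero hpi hs1),
        Complex.cpow_def_of_ne_zero hpi, Complex.cpow_def_of_ne_zero hs1,
        Complex.log_ofReal_mul Real.pi_pos hs1, Complex.ofReal_log Real.pi_pos.le, add_mul,
        Complex.exp_add]
    rw [← mul_assoc, e1, e2, e3]
    ring
  have h := plancherel_laplace hPm hσ hint hint1 hL
  have hexp : ∀ t, Real.exp (-(2 * σ) * t) = Real.exp (-t / X) := by
    intro t; congr 1; rw [hσdef]; field_simp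
  simp only [hexp] at h hint
  exact ⟨hint, h⟩
end LatticeDiscrepancy

namespace LatticeDiscrepancy

/-- The quadratic Gauss sum `∑ e((m h - a h²) / q)` over the residues `h` modulo `q`. -/
noncomputable def quadGauss (q : ℕ) [NeZero q] (a m : ZMod q) : ℂ :=
  ∑ h : ZMod q, ZMod.stdAddChar (m * h - a * h ^ 2)

theorem quadGauss_mul_conj (q : ℕ) [NeZero q] {a : ZMod q} (ha : IsUnit a) (m : ZMod q) :
    quadGauss q a m * (starRingEnd ℂ) (quadGauss q a m) =
      q * ∑ d : ZMod q with 2 * d = 0, ZMod.stdAddChar (m * d - a * d ^ 2) := by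
  classical
  rw [quadGauss, map_sum, Finset.sum_mul_sum, Finset.sum_comm]
  have h1 : ∀ h' : ZMod q, ∑ h : ZMod q, ZMod.stdAddChar (m * h - a * h ^ 2) *
      (starRingEnd ℂ) (ZMod.stdAddChar (m * h' - a * h' ^ 2)) =
      ∑ d : ZMod q, (ZMod.stdAddChar (m * d - a * d ^ 2) : ℂ) *
        ZMod.stdAddChar (h' * (-(2 * a * d))) := by
    intro h'
    rw [← Equiv.sum_comp (Equiv.addLeft h')]
    refine Finset.sum_congr rfl fun d _ => ?_
    rw [← AddChar.map_neg_eq_conj, ← AddChar.map_add_eq_mul, ← AddChar.map_add_eq_mul]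
    congr 1
    simp only [Equiv.coe_addLeft]
    ring
  simp only [h1]
  rw [Finset.sum_comm, Finset.mul_sum, Finset.sum_filter]
  refine Finset.sum_congr rfl fun d _ => ?_
  rw [← Finset.mul_sum, AddChar.sum_mulShift _ (ZMod.isPrimitive_stdAddChar q), ZMod.card]
  have : -(2 * a * d) = 0 ↔ 2 * d = 0 := by
    rw [neg_eq_zero, mul_right_comm, mul_comm, ha.mul_right_eq_zero]
  simp only [this]
  split_ifs <;> ring

theorem zmod_two_mul_eq_zero {q : ℕ} [NeZero q] {d : ZMod q} (hd : 2 * d = 0) :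
    d = 0 ∨ 2 * d.val = q := by
  have h : ((2 * d.val : ℕ) : ZMod q) = 0 := by
    push_cast
    rw [ZMod.natCast_zmod_val, hd]
  rw [ZMod.natCast_eq_zero_iff] at h
  have hlt := d.val_lt
  obtain ⟨c, hc⟩ := h
  have hc2 : c < 2 := by
    by_contra! h2
    have : q * 2 ≤ q * c := Nat.mul_le_mul_left q h2
    omega
  interval_cases c
  · left
    rw [← ZMod.val_eq_zero]
    omega
  · right
    omega

theorem zmod_two_torsion_of_odd {q : ℕ} [NeZero q] (hq : Odd q) :
    (Finset.univ.filter fun d : ZMod q => 2 * d = 0) = {0} := by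
  ext d
  simp only [Finset.mem_filter, Finset.mem_univ, true_and, Finset.mem_singleton]
  refine ⟨fun h => (zmod_two_mul_eq_zero h).resolve_right fun h2 => ?_, by rintro rfl; simp⟩
  rw [← h2] at hq
  exact (Nat.not_odd_iff_even.2 (even_two_mul _)) hq

theorem zmod_two_torsion_of_even {n : ℕ} [NeZero (2 * n)] :
    (Finset.univ.filter fun d : ZMod (2 * n) => 2 * d = 0) = {0, (n : ZMod (2 * n))} := by
  ext d
  simp only [Finset.mem_filter, Finset.mem_univ, true_and, Finset.mem_insert,
    Finset.mem_singleton]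
  constructor
  · intro h
    refine (zmod_two_mul_eq_zero h).imp_right fun h2 => ?_
    have : d.val = n := by omega
    exact (ZMod.natCast_zmod_val d).symm.trans (congrArg _ this)
  · rintro (rfl | rfl)
    · simp
    · have := ZMod.natCast_self (2 * n)
      push_cast at this
      exact this

/-- The normalised square modulus `‖G(a, 0; q)‖² / q` of a quadratic Gauss sum. -/
def gaussWeight (q : ℕ) : ℝ := if Odd q then 1 else if 4 ∣ q then 2 else 0

theorem gaussWeight_nonneg (q : ℕ) : 0 ≤ gaussWeight q := by
  unfold gaussWeight; split_ifs <;> norm_num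

theorem gaussWeight_le_two (q : ℕ) : gaussWeight q ≤ 2 := by
  unfold gaussWeight; split_ifs <;> norm_num

theorem quadGauss_norm_sq_le (q : ℕ) [NeZero q] {a : ZMod q} (ha : IsUnit a) (m : ZMod q) :
    ‖quadGauss q a m‖ ^ 2 ≤ 2 * q := by
  have h := congrArg norm (quadGauss_mul_conj q ha m)
  rw [norm_mul, Complex.norm_conj, ← sq, norm_mul, Complex.norm_natCast] at h
  rw [h, mul_comm]
  gcongr
  refine (norm_sum_le _ _).trans ?_
  simp only [AddChar.norm_apply]
  rw [Finset.sum_const, nsmul_eq_mul, mul_one]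
  rcases Nat.even_or_odd' q with ⟨n, rfl | rfl⟩
  · rw [zmod_two_torsion_of_even]
    exact_mod_cast Finset.card_le_two
  · rw [zmod_two_torsion_of_odd (by simp)]
    simp

theorem quadGauss_zero_norm_sq (q : ℕ) [NeZero q] {a : ℤ} (ha : IsUnit (a : ZMod q)) :
    ‖quadGauss q a 0‖ ^ 2 = q * gaussWeight q := by
  have h := quadGauss_mul_conj q ha 0
  rw [Complex.mul_conj, Complex.normSq_eq_norm_sq] at h
  have key : ∑ d : ZMod q with 2 * d = 0,
      (ZMod.stdAddChar (0 * d - (a : ZMod q) * d ^ 2) : ℂ) = (gaussWeight q : ℂ) := by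
    rcases Nat.even_or_odd' q with ⟨n, rfl | rfl⟩
    · have hn : n ≠ 0 := by
        rintro rfl; exact NeZero.ne (2 * 0) rfl
      have hne : (0 : ZMod (2 * n)) ≠ (n : ZMod (2 * n)) := by
        intro h0
        have := (ZMod.natCast_eq_zero_iff n (2 * n)).1 h0.symm
        exact absurd (Nat.le_of_dvd (by omega) this) (by omega)
      rw [zmod_two_torsion_of_even, Finset.sum_pair hne, gaussWeight, if_neg (by simp)]
      have hcast : (0 * (n : ZMod (2 * n)) - (a : ZMod (2 * n)) * (n : ZMod (2 * n)) ^ 2)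
          = ((-(a * n ^ 2) : ℤ) : ZMod (2 * n)) := by push_cast; ring
      rw [hcast, ZMod.stdAddChar_coe]
      have hexp : 2 * (π : ℂ) * Complex.I * ((-(a * n ^ 2) : ℤ) : ℂ) / ((2 * n : ℕ) : ℂ)
          = ((-(a * n) : ℤ) : ℂ) * (π * Complex.I) := by
        have : (n : ℂ) ≠ 0 := by exact_mod_cast hn
        push_cast
        field_simp
      rw [hexp, Complex.exp_int_mul, Complex.exp_pi_mul_I]
      have h4 : 4 ∣ 2 * n ↔ Even n := by
        rw [even_iff_two_dvd]; omega
      simp only [h4]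
      rcases Nat.even_or_odd n with he | ho
      · rw [if_pos he, Even.neg_one_zpow ((he.natCast.mul_left a).neg)]
        norm_num
      · have hao : Odd a := by
          by_contra hea
          rw [Int.not_odd_iff_even] at hea
          obtain ⟨b, rfl⟩ := hea.exists_two_nsmul
          have h2 : ((b * 2 * n : ℤ) : ZMod (2 * n)) = 0 := by
            have := ZMod.natCast_self (2 * n)
            push_cast at this ⊢
            rw [mul_assoc, this, mul_zero]
          have h3 : (((2 • b : ℤ)) : ZMod (2 * n)) * (n : ZMod (2 * n)) = 0 := by
            rw [← h2, two_nsmul]; push_cast; ring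
          exact hne (ha.mul_right_eq_zero.1 h3).symm
        rw [if_neg (Nat.not_even_iff_odd.2 ho),
          Odd.neg_one_zpow ((hao.mul (by exact_mod_cast ho)).neg)]
        norm_num
    · rw [zmod_two_torsion_of_odd (by simp), Finset.sum_singleton, gaussWeight, if_pos (by simp)]
      simp
  rw [key] at h
  exact_mod_cast h
end LatticeDiscrepancy

namespace LatticeDiscrepancy
open Set

theorem sum_fin_natCast_zmod (q : ℕ) [NeZero q] (F : ZMod q → ℂ) :
    ∑ h : Fin q, F ((h : ℕ) : ZMod q) = ∑ h : ZMod q, F h := by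
  refine Function.Bijective.sum_comp (e := fun h : Fin q => ((h : ℕ) : ZMod q)) ?_ F
  rw [Fintype.bijective_iff_injective_and_card]
  refine ⟨fun a b hab => ?_, by simp [ZMod.card]⟩
  have := (ZMod.natCast_eq_natCast_iff' _ _ _).1 hab
  rw [Nat.mod_eq_of_lt a.2, Nat.mod_eq_of_lt b.2] at this
  exact Fin.ext this

/-- The theta series near the rational point `a / q`, after Poisson summation in each residue
class. -/
theorem theta_near_rational (q : ℕ) [NeZero q] (a : ℤ) {z : ℂ} (hz : 0 < z.re) :
    theta (z + 2 * π * (a / q) * Complex.I) = 1 / (z * q ^ 2 / π) ^ (1 / 2 : ℂ) *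
      ∑' m : ℤ, quadGauss q a m * Complex.exp (-(π ^ 2 / (q ^ 2 * z)) * (m : ℂ) ^ 2) := by
  have hq : (q : ℂ) ≠ 0 := by exact_mod_cast NeZero.ne q
  have hq' : (0 : ℝ) < q := by exact_mod_cast Nat.pos_of_ne_zero (NeZero.ne q)
  have hpi : (π : ℂ) ≠ 0 := by exact_mod_cast Real.pi_ne_zero
  have hz0 : z ≠ 0 := by rintro rfl; simp at hz
  have hs : 0 < (z + 2 * π * (a / q) * Complex.I).re := by
    have : (2 * (π : ℂ) * (a / q) * Complex.I) = ((2 * π * (a / q) : ℝ) : ℂ) * Complex.I := by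
      push_cast; ring
    rw [this]; simpa using hz
  have hA : 0 < (z * q ^ 2 / π).re := by
    have : z * q ^ 2 / π = z * ((q ^ 2 / π : ℝ) : ℂ) := by push_cast; ring
    rw [this, Complex.re_mul_ofReal]; positivity
  have hw : 0 < ((π : ℂ) ^ 2 / (q ^ 2 * z)).re := by
    have : (π : ℂ) ^ 2 / (q ^ 2 * z) = z⁻¹ * ((π ^ 2 / q ^ 2 : ℝ) : ℂ) := by
      push_cast; field_simp
    rw [this, Complex.re_mul_ofReal, Complex.inv_re]
    have := Complex.normSq_pos.2 hz0
    positivity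
  have hsum := summable_theta hs
  rw [theta, ← (Int.divModEquiv q).symm.tsum_eq]
  refine (((Int.divModEquiv q).symm.summable_iff.2 hsum).tsum_prod).trans ?_
  simp only [tsum_fintype, Function.comp_apply]
  have hchar : ∀ (j : ℤ) (h : Fin q),
      Complex.exp (-(z + 2 * π * (a / q) * Complex.I) *
        (((Int.divModEquiv q).symm (j, h) : ℤ) : ℂ) ^ 2) =
      ZMod.stdAddChar (-(a : ZMod q) * (((h : ℕ) : ZMod q)) ^ 2) *
        (Complex.exp (-z * (h : ℕ) ^ 2) *
        Complex.exp (-π * (z * q ^ 2 / π) * (j : ℂ) ^ 2 +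
          2 * π * (-z * q * (h : ℕ) / π) * j)) := by
    intro j h
    have h1 : (-(a : ZMod q) * (((h : ℕ) : ZMod q)) ^ 2) =
        ((-(a * (j * q + (h : ℕ)) ^ 2) : ℤ) : ZMod q) := by
      push_cast; simp
    rw [h1, ZMod.stdAddChar_coe, ← Complex.exp_add, ← Complex.exp_add]
    congr 1
    simp only [Int.divModEquiv, Equiv.coe_fn_symm_mk]
    push_cast
    field_simp
    ring
  simp only [hchar]
  have hsj : ∀ h : Fin q, Summable fun j : ℤ =>
      Complex.exp (-π * (z * q ^ 2 / π) * (j : ℂ) ^ 2 +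
          2 * π * (-z * q * (h : ℕ) / π) * j) := by
    intro h
    have := ((Int.divModEquiv q).symm.summable_iff.2 hsum).comp_injective
      (i := fun j : ℤ => (j, h)) (fun x y hxy => (Prod.mk.inj hxy).1)
    have h2 := this.congr (fun j => hchar j h)
    rw [summable_mul_left_iff, summable_mul_left_iff] at h2
    · exact h2
    · exact Complex.exp_ne_zero _
    · intro h0
      have := AddChar.norm_apply (ZMod.stdAddChar (N := q))
        (-(a : ZMod q) * (((h : ℕ) : ZMod q)) ^ 2)
      rw [h0] at this
      simp at this
  rw [Summable.tsum_finsetSum fun h _ => ((hsj h).mul_left _).mul_left _]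
  simp only [tsum_mul_left, Complex.tsum_exp_neg_quadratic hA]
  have hexp : ∀ (h : Fin q) (n : ℤ), Complex.exp (-z * (h : ℕ) ^ 2) *
      Complex.exp (-π / (z * q ^ 2 / π) * (n + Complex.I * (-z * q * (h : ℕ) / π)) ^ 2) =
      ZMod.stdAddChar ((n : ZMod q) * ((h : ℕ) : ZMod q)) *
        Complex.exp (-(π ^ 2 / (q ^ 2 * z)) * (n : ℂ) ^ 2) := by
    intro h n
    have h1 : ((n : ZMod q) * ((h : ℕ) : ZMod q)) = ((n * (h : ℕ) : ℤ) : ZMod q) := by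
      push_cast; rfl
    rw [h1, ZMod.stdAddChar_coe, ← Complex.exp_add, ← Complex.exp_add]
    congr 1
    push_cast
    field_simp
    linear_combination (- z ^ 2 * q ^ 2 * (h : ℕ) ^ 2) * Complex.I_sq
  have hcomb : ∀ h : Fin q, ZMod.stdAddChar (-(a : ZMod q) * (((h : ℕ) : ZMod q)) ^ 2) *
        (Complex.exp (-z * (h : ℕ) ^ 2) * (1 / (z * q ^ 2 / π) ^ (1 / 2 : ℂ) *
        ∑' n : ℤ, Complex.exp (-π / (z * q ^ 2 / π) *
          (n + Complex.I * (-z * q * (h : ℕ) / π)) ^ 2))) =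
      1 / (z * q ^ 2 / π) ^ (1 / 2 : ℂ) * ∑' n : ℤ,
        ZMod.stdAddChar ((n : ZMod q) * ((h : ℕ) : ZMod q) -
          (a : ZMod q) * (((h : ℕ) : ZMod q)) ^ 2) *
          Complex.exp (-(π ^ 2 / (q ^ 2 * z)) * (n : ℂ) ^ 2) := by
    intro h
    rw [mul_left_comm (Complex.exp _), mul_left_comm, ← tsum_mul_left, ← tsum_mul_left]
    congr 1
    refine tsum_congr fun n => ?_
    rw [hexp, ← mul_assoc, ← AddChar.map_add_eq_mul]
    congr 2
    ring
  simp only [hcomb]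
  rw [← Finset.mul_sum, ← Summable.tsum_finsetSum]
  · congr 1
    refine tsum_congr fun n => ?_
    rw [← Finset.sum_mul, quadGauss, ← sum_fin_natCast_zmod]
  · intro h _
    refine Summable.of_norm ?_
    simp only [norm_mul, AddChar.norm_apply, one_mul]
    exact (summable_theta hw).norm

/-- The main term of the theta series near the rational point `a / q`. -/
noncomputable def thetaMain (q : ℕ) [NeZero q] (a : ℤ) (z : ℂ) : ℂ :=
  quadGauss q a 0 / (z * q ^ 2 / π) ^ (1 / 2 : ℂ)

theorem norm_sqrt_sq (w : ℂ) : ‖w ^ (1 / 2 : ℂ)‖ ^ 2 = ‖w‖ := by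
  have := Complex.cpow_nat_inv_pow w (n := 2) (by norm_num)
  rw [← norm_pow, one_div]
  exact congrArg norm this

theorem thetaMain_norm_sq (q : ℕ) [NeZero q] {a : ℤ} (ha : IsUnit (a : ZMod q)) {z : ℂ} :
    ‖thetaMain q a z‖ ^ 2 = π * gaussWeight q / (q * ‖z‖) := by
  have hq : (q : ℝ) ≠ 0 := by exact_mod_cast NeZero.ne q
  rw [thetaMain, norm_div, div_pow, norm_sqrt_sq, quadGauss_zero_norm_sq q ha]
  simp only [norm_div, norm_mul, norm_pow, Complex.norm_natCast, Complex.norm_real,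
    Real.norm_eq_abs, abs_of_pos Real.pi_pos]
  rcases eq_or_ne ‖z‖ 0 with h | h
  · simp [h]
  field_simp

theorem theta_sub_thetaMain_le (k : ℕ) (hk : 1 ≤ k) : ∃ C : ℝ, 0 ≤ C ∧
    ∀ (q : ℕ) [NeZero q] (a : ℤ), IsUnit (a : ZMod q) → ∀ z : ℂ, 0 < z.re →
    ‖theta (z + 2 * π * (a / q) * Complex.I) - thetaMain q a z‖ ≤
      C * (√(q * ‖z‖))⁻¹ * ((q * ‖z‖) ^ 2 / z.re) ^ k := by
  set S : ℝ := ∑' m : ℤ, 1 / (m : ℝ) ^ (2 * k) with hS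
  have hSs : Summable fun m : ℤ => 1 / (m : ℝ) ^ (2 * k) :=
    Real.summable_one_div_int_pow.2 (by omega)
  have hS0 : 0 ≤ S := tsum_nonneg fun m => by
    rw [pow_mul]; positivity
  refine ⟨√(2 * π) * k.factorial / (π ^ 2) ^ k * S, by positivity, ?_⟩
  intro q _ a ha z hz
  have hq : (0 : ℝ) < q := by exact_mod_cast Nat.pos_of_ne_zero (NeZero.ne q)
  have hz0 : z ≠ 0 := by rintro rfl; simp at hz
  have hzn : 0 < ‖z‖ := norm_pos_iff.2 hz0
  have hqc : (q : ℂ) ≠ 0 := by exact_mod_cast NeZero.ne q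
  have hre : ((π : ℂ) ^ 2 / (q ^ 2 * z)).re = π ^ 2 / ((q * ‖z‖) ^ 2 / z.re) := by
    have : (π : ℂ) ^ 2 / (q ^ 2 * z) = z⁻¹ * ((π ^ 2 / q ^ 2 : ℝ) : ℂ) := by
      push_cast; field_simp
    rw [this, Complex.re_mul_ofReal, Complex.inv_re, Complex.normSq_eq_norm_sq]
    field_simp
  set W : ℝ := (q * ‖z‖) ^ 2 / z.re with hW
  have hWpos : 0 < W := by positivity
  clear_value W
  have hterm : ∀ m : ℤ, ‖Complex.exp (-(π ^ 2 / (q ^ 2 * z)) * (m : ℂ) ^ 2)‖ =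
      Real.exp (-(π ^ 2 / W * (m : ℝ) ^ 2)) := by
    intro m
    rw [Complex.norm_exp]
    congr 1
    have : ((m : ℂ) ^ 2) = (((m : ℝ) ^ 2 : ℝ) : ℂ) := by push_cast; rfl
    rw [this, Complex.re_mul_ofReal, Complex.neg_re, hre]; ring
  have hgn : ∀ m : ℤ, ‖quadGauss q a m‖ ≤ √(2 * q) := fun m =>
    Real.le_sqrt_of_sq_le (quadGauss_norm_sq_le q ha m)
  have hw : 0 < ((π : ℂ) ^ 2 / (q ^ 2 * z)).re := by rw [hre]; positivity
  have hsummable : Summable fun m : ℤ =>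
      quadGauss q a m * Complex.exp (-(π ^ 2 / (q ^ 2 * z)) * (m : ℂ) ^ 2) := by
    refine Summable.of_norm_bounded ((summable_theta hw).norm.mul_left (√(2 * q))) fun m => ?_
    rw [norm_mul]
    gcongr
    exact hgn m
  rw [theta_near_rational q a hz, hsummable.tsum_eq_add_tsum_ite 0, thetaMain]
  simp only [Int.cast_zero, ne_eq, OfNat.ofNat_ne_zero, not_false_eq_true, zero_pow, mul_zero,
    Complex.exp_zero, mul_one]
  rw [mul_add, one_div_mul_eq_div, add_sub_cancel_left, norm_mul]
  have hκ : ‖1 / (z * q ^ 2 / π) ^ (1 / 2 : ℂ)‖ = √(π / (q ^ 2 * ‖z‖)) := by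
    rw [eq_comm, Real.sqrt_eq_iff_eq_sq (by positivity) (norm_nonneg _), norm_div, div_pow,
      norm_sqrt_sq]
    simp only [norm_div, norm_mul, norm_pow, Complex.norm_natCast, Complex.norm_real,
      Real.norm_eq_abs, abs_of_pos Real.pi_pos, norm_one]
    field_simp
  have htail : ‖∑' m : ℤ, if m = 0 then 0 else
      quadGauss q a m * Complex.exp (-(π ^ 2 / (q ^ 2 * z)) * (m : ℂ) ^ 2)‖ ≤
      √(2 * q) * (k.factorial * (W / π ^ 2) ^ k) * S := by
    refine tsum_of_norm_bounded (hSs.hasSum.mul_left _) fun m => ?_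
    split_ifs with hm
    · subst hm
      simp
      rw [zero_pow (by omega)]
      simp
    · rw [norm_mul, hterm, mul_assoc]
      gcongr
      · exact hgn m
      · have hm' : (m : ℝ) ≠ 0 := by exact_mod_cast hm
        have hy : 0 < π ^ 2 / W * (m : ℝ) ^ 2 := by positivity
        have := Real.pow_div_factorial_le_exp _ hy.le k
        rw [Real.exp_neg]
        calc (Real.exp (π ^ 2 / W * (m : ℝ) ^ 2))⁻¹
            ≤ ((π ^ 2 / W * (m : ℝ) ^ 2) ^ k / k.factorial)⁻¹ := by gcongr
          _ = _ := by
            rw [pow_mul, mul_pow, div_pow, div_pow]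
            field_simp
  rw [hκ]
  calc _ ≤ √(π / (q ^ 2 * ‖z‖)) * (√(2 * q) * (k.factorial * (W / π ^ 2) ^ k) * S) := by gcongr
    _ = (√(π / (q ^ 2 * ‖z‖)) * √(2 * q)) * (k.factorial * (W / π ^ 2) ^ k) * S := by ring
    _ = (√(2 * π) * (√(q * ‖z‖))⁻¹) * (k.factorial * (W / π ^ 2) ^ k) * S := by
      rw [← Real.sqrt_mul (by positivity), ← Real.sqrt_inv, ← Real.sqrt_mul (by positivity)]
      have : π / (q ^ 2 * ‖z‖) * (2 * q) = 2 * π * (q * ‖z‖)⁻¹ := by field_simp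
      rw [this]
    _ = _ := by
      rw [div_pow]; field_simp

end LatticeDiscrepancy

namespace LatticeDiscrepancy
open Set

theorem norm_pow_sub_pow_le {E : Type*} [NormedCommRing E] [NormOneClass E] {a b : E} {B δ : ℝ}
    (ha : ‖a‖ ≤ B) (hb : ‖b‖ ≤ B) (hab : ‖a - b‖ ≤ B * δ) (n : ℕ) :
    ‖a ^ n - b ^ n‖ ≤ n * B ^ n * δ := by
  have hB : 0 ≤ B := (norm_nonneg _).trans ha
  induction n with
  | zero => simp
  | succ n ih =>
    have : a ^ (n + 1) - b ^ (n + 1) = a ^ n * (a - b) + (a ^ n - b ^ n) * b := by ring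
    rw [this]
    calc _ ≤ ‖a ^ n * (a - b)‖ + ‖(a ^ n - b ^ n) * b‖ := norm_add_le _ _
      _ ≤ ‖a‖ ^ n * ‖a - b‖ + ‖a ^ n - b ^ n‖ * ‖b‖ :=
          add_le_add ((norm_mul_le _ _).trans (by gcongr; exact norm_pow_le _ _))
            (norm_mul_le _ _)
      _ ≤ B ^ n * (B * δ) + (n * B ^ n * δ) * B := by
          have : 0 ≤ n * B ^ n * δ := (norm_nonneg _).trans ih
          gcongr
      _ = _ := by push_cast; ring

instance neZero_rat_den (r : ℚ) : NeZero r.den := ⟨r.den_nz⟩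

theorem isUnit_num_cast (r : ℚ) : IsUnit ((r.num : ℤ) : ZMod r.den) := by
  rw [ZMod.coe_int_isUnit_iff_isCoprime, Int.isCoprime_iff_gcd_eq_one, Int.gcd_comm]
  exact r.reduced

theorem vline_eq_add (σ x : ℝ) (r : ℚ) :
    vline σ x = vline σ (x - r) + 2 * π * ((r.num : ℂ) / (r.den : ℂ)) * Complex.I := by
  have : ((r : ℝ) : ℂ) = (r.num : ℂ) / (r.den : ℂ) := by
    rw [Complex.ofReal_ratCast, Rat.cast_def]
  simp only [vline, Complex.ofReal_sub, this]
  ring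

theorem norm_vline_ge_left {σ : ℝ} (x : ℝ) : σ ≤ ‖vline σ x‖ := by
  simpa using Complex.re_le_norm (vline σ x)

theorem norm_vline_ge_right {σ : ℝ} (x : ℝ) : 2 * π * |x| ≤ ‖vline σ x‖ := by
  have := Complex.abs_im_le_norm (vline σ x)
  rwa [vline_im, abs_mul, abs_of_pos Real.two_pi_pos] at this

theorem norm_vline_le {σ : ℝ} (hσ : 0 < σ) (x : ℝ) : ‖vline σ x‖ ≤ σ + 2 * π * |x| := by
  have := Complex.norm_le_abs_re_add_abs_im (vline σ x)
  rwa [vline_im, vline_re, abs_mul, abs_of_pos Real.two_pi_pos, abs_of_pos hσ] at this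

/-- Bounds for the theta series on a Farey arc of order `N`. -/
theorem theta_arc_bounds (k : ℕ) (hk : 1 ≤ k) : ∃ C : ℝ, 0 < C ∧
    ∀ (N : ℕ) (σ : ℝ), 1 ≤ N → 1 / 2 ≤ σ * N ^ 2 → σ * N ^ 2 ≤ 2 →
    ∀ (r : ℚ) (x : ℝ), r.den ≤ N → |x - r| ≤ 1 / (r.den * N) →
      ‖theta (vline σ x)‖ ^ (2 * k) ≤ C / (r.den * ‖vline σ (x - r)‖) ^ k ∧
      |‖theta (vline σ x)‖ ^ (2 * k) -
        (π * gaussWeight r.den / (r.den * ‖vline σ (x - r)‖)) ^ k| ≤ C * N ^ k ∧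
      ‖theta (vline σ x) ^ k - thetaMain r.den r.num (vline σ (x - r)) ^ k‖ ^ 2 ≤
        C * N ^ (k + 2) * (r.den * ‖vline σ (x - r)‖) ^ 2 := by
  obtain ⟨C₁, hC₁, h⟩ := theta_sub_thetaMain_le k hk
  set B₁ : ℝ := 3 + C₁ * 2 ^ k with hB₁
  set B : ℝ := B₁ * (1 + 9 ^ (2 * k)) with hB
  have hB₁0 : 0 < B₁ := by positivity
  have hB0 : 0 < B := by positivity
  refine ⟨B ^ (2 * k) + (2 * k : ℕ) * B ^ (2 * k) * 9 ^ k +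
    (k * B ^ k) ^ 2 * 9 ^ (3 * k - 2), by positivity, ?_⟩
  intro N σ hN hσ1 hσ2 r x hr hx
  have hN0 : (0 : ℝ) < N := by exact_mod_cast hN
  have hσ : 0 < σ := by
    by_contra! hneg
    have : σ * (N : ℝ) ^ 2 ≤ 0 := mul_nonpos_of_nonpos_of_nonneg hneg (by positivity)
    linarith
  have hq : (0 : ℝ) < r.den := by exact_mod_cast r.pos
  have hqN : (r.den : ℝ) ≤ N := by exact_mod_cast hr
  set z := vline σ (x - r) with hz
  have hzre : z.re = σ := by simp [hz]
  have hzσ : σ ≤ ‖z‖ := norm_vline_ge_left _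
  have hzle : ‖z‖ ≤ σ + 2 * π * |x - r| := norm_vline_le hσ _
  have hz0 : 0 < ‖z‖ := hσ.trans_le hzσ
  set Q : ℝ := r.den * ‖z‖ with hQ
  have hQ0 : 0 < Q := by positivity
  have hQN : Q * N ≤ 9 := by
    have h1 : (r.den : ℝ) * N * |x - r| ≤ 1 := by
      rw [le_div_iff₀ (by positivity)] at hx; linarith
    have h2 : (r.den : ℝ) * σ * N ≤ 2 := by
      calc (r.den : ℝ) * σ * N ≤ N * σ * N := by gcongr
        _ = σ * N ^ 2 := by ring
        _ ≤ 2 := hσ2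
    calc Q * N ≤ r.den * (σ + 2 * π * |x - r|) * N := by rw [hQ]; gcongr
      _ = (r.den : ℝ) * σ * N + 2 * π * ((r.den : ℝ) * N * |x - r|) := by ring
      _ ≤ 2 + 2 * π * 1 := by gcongr
      _ ≤ 9 := by linarith [Real.pi_lt_d2]
  have hv0 : 0 < Q * N := by positivity
  set M := thetaMain r.den r.num z with hM
  set θ := theta (vline σ x) with hθ
  have hMsq : ‖M‖ ^ 2 = π * gaussWeight r.den / Q :=
    thetaMain_norm_sq r.den (isUnit_num_cast r)
  have hu : ((√Q)⁻¹) ^ 2 = Q⁻¹ := by rw [inv_pow, Real.sq_sqrt hQ0.le]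
  have hu0 : 0 < (√Q)⁻¹ := by positivity
  set u := (√Q)⁻¹ with hudef
  have hMu : ‖M‖ ≤ 3 * u := by
    refine abs_le_of_sq_le_sq' ?_ (by positivity) |>.2
    rw [hMsq, mul_pow, hu, div_eq_mul_inv]
    gcongr
    have := gaussWeight_le_two r.den
    nlinarith [Real.pi_lt_d2, Real.pi_pos]
  have hdiff : ‖θ - M‖ ≤ B₁ * u * (Q * N) ^ (2 * k) := by
    have h1 := h r.den r.num (isUnit_num_cast r) z (by rwa [hzre])
    rw [← vline_eq_add, hzre] at h1
    refine h1.trans ?_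
    have h2 : Q ^ 2 / σ ≤ 2 * (Q * N) ^ 2 := by
      rw [div_le_iff₀ hσ]
      nlinarith [sq_nonneg Q]
    calc C₁ * u * (Q ^ 2 / σ) ^ k ≤ C₁ * u * (2 * (Q * N) ^ 2) ^ k := by gcongr
      _ = (C₁ * 2 ^ k) * u * (Q * N) ^ (2 * k) := by rw [mul_pow, pow_mul]; ring
      _ ≤ _ := by gcongr; linarith
  have hB1B : B₁ ≤ B := by
    rw [hB]; nlinarith [pow_pos (show (0 : ℝ) < 9 by norm_num) (2 * k)]
  have hMB : ‖M‖ ≤ B * u := hMu.trans (by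
    gcongr; exact le_trans (by
      rw [hB₁]
      have := mul_nonneg hC₁ (pow_nonneg (zero_le_two (α := ℝ)) k)
      linarith) hB1B)
  have hdB : ‖θ - M‖ ≤ B * u * (Q * N) ^ (2 * k) := hdiff.trans (by gcongr)
  have hθB : ‖θ‖ ≤ B * u := by
    calc ‖θ‖ = ‖(θ - M) + M‖ := by ring_nf
      _ ≤ ‖θ - M‖ + ‖M‖ := norm_add_le _ _
      _ ≤ B₁ * u * 9 ^ (2 * k) + B₁ * u := by
        refine add_le_add (hdiff.trans (by gcongr)) (hMu.trans ?_)
        gcongr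
        have := mul_nonneg hC₁ (pow_nonneg (zero_le_two (α := ℝ)) k); linarith
      _ = B * u := by rw [hB]; ring
  have hu2k : u ^ (2 * k) = (Q ^ k)⁻¹ := by rw [pow_mul, hu, inv_pow]
  have hC2 : (0 : ℝ) ≤ B ^ (2 * k) := by positivity
  have hC3 : (0 : ℝ) ≤ (2 * k : ℕ) * B ^ (2 * k) * 9 ^ k := by positivity
  have hC4 : (0 : ℝ) ≤ (k * B ^ k) ^ 2 * 9 ^ (3 * k - 2) := by positivity
  refine ⟨?_, ?_, ?_⟩
  · calc ‖θ‖ ^ (2 * k) ≤ (B * u) ^ (2 * k) := by gcongr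
      _ = B ^ (2 * k) / Q ^ k := by rw [mul_pow, hu2k]; rfl
      _ ≤ _ := by gcongr; linarith
  · have h1 : (π * gaussWeight r.den / Q) ^ k = ‖M‖ ^ (2 * k) := by rw [pow_mul, hMsq]
    rw [h1, ← Real.norm_eq_abs]
    have h2 := norm_pow_sub_pow_le (a := ‖θ‖) (b := ‖M‖) (B := B * u) (δ := (Q * N) ^ (2 * k))
      (by simpa using hθB) (by simpa using hMB)
      (by rw [Real.norm_eq_abs]; exact (abs_norm_sub_norm_le _ _).trans hdB) (2 * k)
    refine h2.trans ?_
    calc ((2 * k : ℕ) : ℝ) * (B * u) ^ (2 * k) * (Q * N) ^ (2 * k)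
        = (2 * k : ℕ) * B ^ (2 * k) * (Q * N) ^ k * N ^ k := by
          rw [mul_pow, hu2k, mul_pow Q, mul_pow Q]
          field_simp
          ring
      _ ≤ (2 * k : ℕ) * B ^ (2 * k) * 9 ^ k * N ^ k := by gcongr
      _ ≤ _ := by gcongr; linarith
  · have h2 := norm_pow_sub_pow_le (a := θ) (b := M) (B := B * u) (δ := (Q * N) ^ (2 * k))
      hθB hMB hdB k
    calc ‖θ ^ k - M ^ k‖ ^ 2 ≤ (k * (B * u) ^ k * (Q * N) ^ (2 * k)) ^ 2 := by gcongr
      _ = (k * B ^ k) ^ 2 * (Q * N) ^ (3 * k - 2) * (N ^ (k + 2) * Q ^ 2) := by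
          have e1 : (k * (B * u) ^ k * (Q * N) ^ (2 * k)) ^ 2 =
            (k * B ^ k) ^ 2 * u ^ (2 * k) * (Q * N) ^ (4 * k) := by ring_nf
          have e2 : (Q * N) ^ (4 * k) = (Q * N) ^ (3 * k - 2) * (Q * N) ^ (k + 2) := by
            rw [← pow_add]; congr 1; omega
          rw [e1, e2, hu2k, mul_pow Q (N : ℝ) (k + 2), pow_add Q k 2]
          field_simp
      _ ≤ (k * B ^ k) ^ 2 * 9 ^ (3 * k - 2) * (N ^ (k + 2) * Q ^ 2) := by gcongr
      _ = (k * B ^ k) ^ 2 * 9 ^ (3 * k - 2) * N ^ (k + 2) * Q ^ 2 := by ring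
      _ ≤ _ := by gcongr; linarith

end LatticeDiscrepancy

namespace LatticeDiscrepancy
open Set

theorem cpow_half_nat (w : ℂ) (k : ℕ) : w ^ ((k : ℂ) / 2) = (w ^ (1 / 2 : ℂ)) ^ k := by
  rw [← Complex.cpow_mul_nat]
  congr 1
  ring

theorem norm_volume_term_sq (s : ℂ) (k : ℕ) :
    ‖((π : ℂ) / s) ^ ((k : ℂ) / 2)‖ ^ 2 = (π / ‖s‖) ^ k := by
  rw [cpow_half_nat, norm_pow, ← pow_mul, mul_comm, pow_mul, norm_sqrt_sq, norm_div,
    Complex.norm_real, Real.norm_eq_abs, abs_of_pos Real.pi_pos]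

theorem thetaMain_one_zero {s : ℂ} (hs : 0 < s.re) :
    thetaMain 1 0 s = ((π : ℂ) / s) ^ (1 / 2 : ℂ) := by
  have h1 : quadGauss 1 ((0 : ℤ) : ZMod 1) 0 = 1 := by
    simp [quadGauss]
  have h2 : (π : ℂ) / s = (s * ((1 : ℕ) : ℂ) ^ 2 / π)⁻¹ := by simp
  have h3 : 0 < (s * ((1 : ℕ) : ℂ) ^ 2 / π).re := by
    have : s * ((1 : ℕ) : ℂ) ^ 2 / π = s * ((π⁻¹ : ℝ) : ℂ) := by push_cast; field_simp
    rw [this, Complex.re_mul_ofReal]; positivity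
  rw [thetaMain, h1, h2, Complex.inv_cpow, one_div]
  intro h
  rw [Complex.arg_eq_pi_iff] at h
  linarith [h.1]

theorem norm_disc_sq (k : ℕ) (s : ℂ) :
    ‖disc k s‖ ^ 2 = ‖theta s ^ k - ((π : ℂ) / s) ^ ((k : ℂ) / 2)‖ ^ 2 / ‖s‖ ^ 2 := by
  rw [disc, norm_div, div_pow]

theorem disc_central_arc_le (k : ℕ) (hk : 1 ≤ k) : ∃ C : ℝ, 0 < C ∧
    ∀ (N : ℕ) (σ : ℝ), 1 ≤ N → 1 / 2 ≤ σ * N ^ 2 → σ * N ^ 2 ≤ 2 →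
    ∀ x : ℝ, |x| ≤ 1 / N → ‖disc k (vline σ x)‖ ^ 2 ≤ C * N ^ (k + 2) := by
  obtain ⟨C, hC, h⟩ := theta_arc_bounds k hk
  refine ⟨C, hC, fun N σ hN hσ1 hσ2 x hx => ?_⟩
  have hN0 : (0 : ℝ) < N := by exact_mod_cast hN
  have hσ : 0 < σ := by
    by_contra! hneg
    have : σ * (N : ℝ) ^ 2 ≤ 0 := mul_nonpos_of_nonpos_of_nonneg hneg (by positivity)
    linarith
  have h0 : 0 < ‖vline σ x‖ := hσ.trans_le (norm_vline_ge_left _)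
  have h1 := (h N σ hN hσ1 hσ2 0 x (by simpa using hN) (by simpa using hx)).2.2
  have h2 : thetaMain (0 : ℚ).den (0 : ℚ).num (vline σ (x - (0 : ℚ))) = thetaMain 1 0 (vline σ x) := by
    rw [Rat.cast_zero, sub_zero]; rfl
  rw [h2, thetaMain_one_zero (by simpa using hσ), ← cpow_half_nat] at h1
  rw [norm_disc_sq, div_le_iff₀ (by positivity)]
  simpa using h1

theorem sq_norm_sub_le {E : Type*} [SeminormedAddCommGroup E] (a b : E) :
    ‖a - b‖ ^ 2 ≤ 2 * (‖a‖ ^ 2 + ‖b‖ ^ 2) := by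
  have := norm_sub_le a b
  nlinarith [norm_nonneg (a - b), sq_nonneg (‖a‖ - ‖b‖)]

theorem disc_off_arcs_le (k : ℕ) (hk : 1 ≤ k) : ∃ C : ℝ, 0 < C ∧
    ∀ (N : ℕ) (σ : ℝ), 1 ≤ N → 1 / 2 ≤ σ * N ^ 2 → σ * N ^ 2 ≤ 2 →
    ∀ x : ℝ, (∀ r : ℚ, r.den ≤ N → 1 / (2 * r.den * N) ≤ |x - r|) →
      ‖disc k (vline σ x)‖ ^ 2 ≤ C * N ^ k * (‖vline (1 / N) x‖ ^ 2)⁻¹ := by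
  obtain ⟨C, hC, h⟩ := theta_arc_bounds k hk
  refine ⟨4 * (C + 1), by positivity, fun N σ hN hσ1 hσ2 x hx => ?_⟩
  have hN0 : (0 : ℝ) < N := by exact_mod_cast hN
  have hpi3 := Real.pi_gt_three
  obtain ⟨r, hr1, hr2⟩ := Real.exists_rat_abs_sub_le_and_den_le x hN
  have hq : (0 : ℝ) < r.den := by exact_mod_cast r.pos
  have hr3 : |x - r| ≤ 1 / (r.den * N) := by
    refine hr1.trans ?_
    gcongr 1 / ?_
    nlinarith
  have hb := (h N σ hN hσ1 hσ2 r x hr2 hr3).1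
  have hQ : 1 / (N : ℝ) ≤ r.den * ‖vline σ (x - r)‖ := by
    have h1 := hx r hr2
    have h2 := norm_vline_ge_right (σ := σ) (x - r)
    calc 1 / (N : ℝ) = r.den * (2 * (1 / (2 * r.den * N))) := by field_simp
      _ ≤ r.den * (2 * π * (1 / (2 * r.den * N))) := by
        gcongr
        linarith
      _ ≤ r.den * (2 * π * |x - r|) := by gcongr
      _ ≤ _ := by gcongr
  have hx0 : 1 / (2 * (N : ℝ)) ≤ |x| := by simpa using hx 0 (by simpa using hN)
  have hxpos : 0 < |x| := lt_of_lt_of_le (by positivity) hx0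
  have hs : 2 * π * |x| ≤ ‖vline σ x‖ := norm_vline_ge_right x
  have hspos : 0 < ‖vline σ x‖ := lt_of_lt_of_le (by positivity) hs
  have hθ : ‖theta (vline σ x)‖ ^ (2 * k) ≤ C * N ^ k := by
    refine hb.trans ?_
    calc C / (r.den * ‖vline σ (x - r)‖) ^ k ≤ C / (1 / (N : ℝ)) ^ k := by gcongr
      _ = C * N ^ k := by rw [one_div, inv_pow, div_inv_eq_mul]
  have hB : (π / ‖vline σ x‖) ^ k ≤ N ^ k := by
    gcongr
    rw [div_le_iff₀ hspos]
    calc π = N * (2 * π * (1 / (2 * N))) := by field_simp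
      _ ≤ N * (2 * π * |x|) := by gcongr
      _ ≤ _ := by gcongr
  have hnum : ‖theta (vline σ x) ^ k - ((π : ℂ) / vline σ x) ^ ((k : ℂ) / 2)‖ ^ 2 ≤
      2 * (C + 1) * N ^ k := by
    refine (sq_norm_sub_le _ _).trans ?_
    rw [norm_volume_term_sq, norm_pow, ← pow_mul, mul_comm k 2]
    nlinarith
  have hden : ‖vline (1 / (N : ℝ)) x‖ ^ 2 ≤ 2 * ‖vline σ x‖ ^ 2 := by
    have h1 : (1 / (N : ℝ)) ≤ 2 * |x| := by
      calc (1 / (N : ℝ)) = 2 * (1 / (2 * N)) := by field_simp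
        _ ≤ _ := by gcongr
    have h2 : (1 / (N : ℝ)) ^ 2 ≤ (2 * |x|) ^ 2 := by gcongr
    have h3 : (2 * |x|) ^ 2 ≤ (2 * π * x) ^ 2 := by
      rw [mul_pow, sq_abs, mul_pow, mul_pow]
      have : (1 : ℝ) ≤ π ^ 2 := by nlinarith
      nlinarith [sq_nonneg x]
    rw [vline_norm_sq, vline_norm_sq]
    nlinarith [sq_nonneg σ]
  have hdpos : 0 < ‖vline (1 / (N : ℝ)) x‖ := lt_of_lt_of_le (by positivity) (norm_vline_ge_left x)
  rw [norm_disc_sq, div_le_iff₀ (by positivity), ← div_eq_mul_inv, div_mul_eq_mul_div,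
    le_div_iff₀ (by positivity)]
  calc _ ≤ 2 * (C + 1) * N ^ k * (2 * ‖vline σ x‖ ^ 2) := by gcongr
    _ = _ := by ring

/-- The weight with which the Farey arc around `r` contributes to the mean square. -/
noncomputable def arcWeight (k : ℕ) (r : ℚ) : ℝ :=
  (π * gaussWeight r.den / r.den) ^ k / (2 * π * r) ^ 2

theorem arcWeight_nonneg (k : ℕ) (r : ℚ) : 0 ≤ arcWeight k r := by
  have := gaussWeight_nonneg r.den
  have := Real.pi_pos
  unfold arcWeight; positivity

theorem arcWeight_le (k : ℕ) (r : ℚ) :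
    arcWeight k r ≤ (2 * π) ^ k * (1 / (r.num : ℝ) ^ 2) * ((r.den : ℝ) ^ 2 / (r.den : ℝ) ^ k) := by
  have hq : (0 : ℝ) < r.den := by exact_mod_cast r.pos
  have h1 := gaussWeight_nonneg r.den
  have h2 := gaussWeight_le_two r.den
  have hpi := Real.pi_gt_three
  have hr : (r : ℝ) = r.num / r.den := Rat.cast_def r
  rcases eq_or_ne r 0 with rfl | hr0
  · simp [arcWeight]
  have ha : (0 : ℝ) < (r.num : ℝ) ^ 2 := by
    have : (r.num : ℝ) ≠ 0 := by exact_mod_cast Rat.num_ne_zero.2 hr0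
    positivity
  calc arcWeight k r ≤ (2 * π / r.den) ^ k / (1 * r) ^ 2 := by
        unfold arcWeight
        have : (0 : ℝ) < (1 * r : ℝ) ^ 2 := by rw [hr]; rw [one_mul, div_pow]; positivity
        refine div_le_div₀ (by positivity) ?_ this ?_
        · gcongr ?_ ^ k
          rw [mul_comm]; gcongr
        · rw [mul_pow _ (r : ℝ), mul_pow _ (r : ℝ)]
          gcongr
          linarith
    _ = _ := by
      rw [hr, div_pow, one_mul, div_pow]
      field_simp

end LatticeDiscrepancy

namespace LatticeDiscrepancy
open Set

theorem abs_sq_norm_sub_sub_le {E : Type*} [SeminormedAddCommGroup E] (a b : E) :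
    |‖a - b‖ ^ 2 - ‖a‖ ^ 2| ≤ ‖b‖ ^ 2 + 2 * (‖a‖ * ‖b‖) := by
  have h1 := norm_sub_le a b
  have h2 := norm_sub_norm_le a b
  have h3 := norm_nonneg (a - b)
  have h4 := norm_nonneg a
  have h5 := norm_nonneg b
  rw [abs_le]
  constructor
  · rcases le_total ‖a‖ ‖b‖ with h | h
    · nlinarith
    · nlinarith
  · nlinarith

/-- Geometry of a Farey arc away from the origin: the point `x` is comparable to its centre. -/
theorem inv_norm_vline_sq_sub_le {N : ℕ} {σ x : ℝ} {r : ℚ} (hN : 1 ≤ N) (hσ : 0 < σ)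
    (hσ2 : σ * N ^ 2 ≤ 2) (hr0 : r ≠ 0) (hr : r.den ≤ N) (hx : |x - r| ≤ 1 / (2 * r.den * N)) :
    π * |(r : ℝ)| ≤ ‖vline σ x‖ ∧
    |1 / ‖vline σ x‖ ^ 2 - 1 / (2 * π * r) ^ 2| ≤ 18 * ‖vline σ (x - r)‖ / |(r : ℝ)| ^ 3 := by
  have hN1 : (1 : ℝ) ≤ N := by exact_mod_cast hN
  have hN0 : (0 : ℝ) < N := by linarith
  have hq : (0 : ℝ) < r.den := by exact_mod_cast r.pos
  have hq1 : (1 : ℝ) ≤ r.den := by exact_mod_cast r.pos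
  have hqN : (r.den : ℝ) ≤ N := by exact_mod_cast hr
  have hpi := Real.pi_gt_three
  have hpi4 := Real.pi_lt_d2
  have hA : 1 / (r.den : ℝ) ≤ |(r : ℝ)| := by
    have : (1 : ℝ) ≤ |(r.num : ℝ)| := by
      exact_mod_cast Int.one_le_abs (Rat.num_ne_zero.2 hr0)
    rw [Rat.cast_def, abs_div, abs_of_pos hq]
    gcongr
  set A := |(r : ℝ)| with hAdef
  have hA0 : 0 < A := lt_of_lt_of_le (by positivity) hA
  have hAN : 1 / (N : ℝ) ≤ A := le_trans (by gcongr) hA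
  have hxr : |x - r| ≤ A / 2 := by
    refine hx.trans ?_
    calc 1 / (2 * (r.den : ℝ) * N) ≤ 1 / (2 * (r.den : ℝ) * 1) := by gcongr
      _ = 1 / (r.den : ℝ) / 2 := by field_simp
      _ ≤ _ := by gcongr
  have hxl : A / 2 ≤ |x| := by
    have := abs_sub_abs_le_abs_sub (r : ℝ) x
    rw [abs_sub_comm] at this
    linarith
  have hxu : |x + r| ≤ 5 / 2 * A := by
    have : x + r = (x - r) + 2 * r := by ring
    rw [this]
    refine (abs_add_le _ _).trans ?_
    rw [abs_mul, abs_two]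
    linarith
  have hspiA : π * A ≤ ‖vline σ x‖ := by
    refine le_trans ?_ (norm_vline_ge_right x)
    nlinarith
  have hsA : A ≤ ‖vline σ x‖ := by nlinarith
  have hspos : 0 < ‖vline σ x‖ := hA0.trans_le hsA
  refine ⟨hspiA, ?_⟩
  have hσA : σ ≤ 2 * A := by
    have : σ * N ≤ 2 := by nlinarith
    rw [div_le_iff₀ hN0] at hAN
    by_contra! h
    nlinarith
  set Z := ‖vline σ (x - r)‖ with hZ
  have hZ1 : σ ≤ Z := norm_vline_ge_left _
  have hZ2 : 2 * π * |x - r| ≤ Z := norm_vline_ge_right _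
  have hrr : (2 * π * r) ^ 2 = (2 * π * A) ^ 2 := by
    rw [mul_pow, mul_pow _ A, hAdef, sq_abs]
  have h1 : |(2 * π * r) ^ 2 - ‖vline σ x‖ ^ 2| ≤ 18 * Z * A := by
    rw [vline_norm_sq]
    have : (2 * π * r) ^ 2 - (σ ^ 2 + (2 * π * x) ^ 2) =
        -(σ * σ + (2 * π * (x - r)) * (2 * π * (x + r))) := by ring
    rw [this, abs_neg]
    refine (abs_add_le _ _).trans ?_
    rw [abs_mul, abs_mul, abs_of_pos hσ, abs_mul (2 * π), abs_mul (2 * π),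
      abs_of_pos Real.two_pi_pos]
    have e1 : σ * σ ≤ Z * (2 * A) := mul_le_mul hZ1 hσA hσ.le (hσ.le.trans hZ1)
    have e2 : 2 * π * |x - r| * (2 * π * |x + r|) ≤ Z * (2 * π * (5 / 2 * A)) := by
      gcongr
    have e3 : Z * (2 * π * (5 / 2 * A)) ≤ 16 * (Z * A) := by
      have : 0 ≤ Z * A := by positivity
      nlinarith
    linarith
  have hne : (2 * π * (r : ℝ)) ^ 2 ≠ 0 := by rw [hrr]; positivity
  rw [div_sub_div _ _ (by positivity) hne, abs_div, one_mul, mul_one,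
    div_le_div_iff₀ (by positivity) (by positivity)]
  have e4 : A ^ 2 * A ^ 2 ≤ |‖vline σ x‖ ^ 2 * (2 * π * r) ^ 2| := by
    rw [hrr, abs_of_pos (by positivity)]
    gcongr
    nlinarith
  calc |(2 * π * r) ^ 2 - ‖vline σ x‖ ^ 2| * A ^ 3 ≤ (18 * Z * A) * A ^ 3 := by gcongr
    _ = 18 * Z * (A ^ 2 * A ^ 2) := by ring
    _ ≤ _ := by gcongr

theorem cross_term_le {j : ℕ} {Z a q N C Y b : ℝ} (hZ : 0 < Z) (ha : 1 ≤ a) (hq : 0 < q)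
    (hC : 0 < C) (hZN : 1 / Z ≤ 2 * N ^ 2) (hb0 : 0 ≤ b) (hY : Y ≤ C / (q * Z) ^ (j + 5))
    (hb : b ≤ 1 / (a / q) ^ (j + 5)) :
    Y * b ≤ ((C + 1) * 2 ^ (j + 1) * (N ^ (j + 1) * (Z ^ 2)⁻¹)) ^ 2 := by
  have h2 : (1 : ℝ) ≤ 2 ^ (j + 1) := one_le_pow₀ one_le_two
  have ha0 : 0 < a := by linarith
  have h3 : C * 2 ^ (j + 1) ≤ ((C + 1) * 2 ^ (j + 1)) ^ 2 := by
    rw [mul_pow]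
    gcongr
    · nlinarith
    · nlinarith
  have h4 : Z ^ (j + 5) = Z ^ (j + 1) * (Z ^ 2) ^ 2 := by ring
  calc Y * b ≤ C / (q * Z) ^ (j + 5) * (1 / (a / q) ^ (j + 5)) := by gcongr
    _ = C / (a * Z) ^ (j + 5) := by
      rw [div_mul_div_comm, mul_one, ← mul_pow]
      congr 2
      field_simp
    _ ≤ C / (1 * Z) ^ (j + 5) := by gcongr
    _ = C * ((1 / Z) ^ (j + 1) * ((Z ^ 2)⁻¹) ^ 2) := by
      rw [one_mul, h4, one_div_pow, inv_pow, div_eq_mul_inv, mul_inv, one_div]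
    _ ≤ C * ((2 * N ^ 2) ^ (j + 1) * ((Z ^ 2)⁻¹) ^ 2) := by gcongr
    _ = (C * 2 ^ (j + 1)) * (N ^ (j + 1) * (Z ^ 2)⁻¹) ^ 2 := by
      rw [mul_pow, ← pow_mul, mul_pow (_ ^ _) _ 2, ← pow_mul, mul_comm 2 (j + 1)]; ring
    _ ≤ ((C + 1) * 2 ^ (j + 1)) ^ 2 * (N ^ (j + 1) * (Z ^ 2)⁻¹) ^ 2 := by gcongr
    _ = _ := by rw [← mul_pow]

theorem weight_term_le {j : ℕ} {Z a q N W : ℝ} (hZ : 0 < Z) (ha : 1 ≤ a) (hq : 1 ≤ q)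
    (hZN : 1 / Z ≤ 2 * N ^ 2) (hW : W ≤ (2 * π) ^ (j + 5) / (q * Z) ^ (j + 5)) :
    W * (18 * Z / (a / q) ^ 3) ≤ 18 * (2 * π) ^ (j + 5) * 2 ^ (j + 2) * (1 / a ^ 2) *
      (N ^ (2 * j + 4) * (1 / q ^ 2) * (Z ^ 2)⁻¹) := by
  have ha0 : 0 < a := by linarith
  have hq0 : 0 < q := by linarith
  have h1 : (1 : ℝ) / a ^ 3 ≤ 1 / a ^ 2 := by gcongr; norm_num
  have h2 : (1 : ℝ) / q ^ (j + 2) ≤ 1 / q ^ 2 := by gcongr; omega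
  calc W * (18 * Z / (a / q) ^ 3)
      ≤ (2 * π) ^ (j + 5) / (q * Z) ^ (j + 5) * (18 * Z / (a / q) ^ 3) := by gcongr
    _ = 18 * (2 * π) ^ (j + 5) * (1 / a ^ 3) * ((1 / Z) ^ (j + 2) * (1 / q ^ (j + 2)) *
        (Z ^ 2)⁻¹) := by
      have e1 : q ^ (j + 5) = q ^ (j + 2) * q ^ 3 := by ring
      have e2 : Z ^ (j + 5) = Z ^ (j + 2) * Z ^ 2 * Z := by ring
      rw [mul_pow q, div_pow, e1, e2, one_div_pow]
      generalize (2 * π) ^ (j + 5) = t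
      generalize hzj : Z ^ (j + 2) = zj
      generalize hqj : q ^ (j + 2) = qj
      have : 0 < zj := hzj ▸ by positivity
      have : 0 < qj := hqj ▸ by positivity
      field_simp
    _ ≤ 18 * (2 * π) ^ (j + 5) * (1 / a ^ 2) * ((2 * N ^ 2) ^ (j + 2) * (1 / q ^ 2) *
        (Z ^ 2)⁻¹) := by gcongr
    _ = _ := by
      rw [mul_pow 2 (N ^ 2), ← pow_mul, show 2 * (j + 2) = 2 * j + 4 by ring]
      ring

theorem disc_arc_sub_le (j : ℕ) : ∃ C : ℝ, 0 < C ∧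
    ∀ (N : ℕ) (σ : ℝ), 1 ≤ N → 1 / 2 ≤ σ * N ^ 2 → σ * N ^ 2 ≤ 2 →
    ∀ (r : ℚ) (x : ℝ), r ≠ 0 → r.den ≤ N → |x - r| ≤ 1 / (2 * r.den * N) →
      |‖disc (j + 5) (vline σ x)‖ ^ 2 -
        arcWeight (j + 5) r * (‖vline σ (x - r)‖ ^ (j + 5))⁻¹| ≤
      C * (1 / (r.num : ℝ) ^ 2) * (N ^ (j + 5) * r.den ^ 2 +
        (N ^ (j + 1) * r.den ^ 2 + N ^ (2 * j + 4) * (1 / r.den ^ 2)) *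
          (‖vline σ (x - r)‖ ^ 2)⁻¹) := by
  obtain ⟨C, hC, h⟩ := theta_arc_bounds (j + 5) (by omega)
  set k := j + 5 with hk
  refine ⟨(1 + C) + 2 * ((C + 1) * 2 ^ (j + 1)) + 18 * (2 * π) ^ k * 2 ^ (j + 2),
    by positivity, fun N σ hN hσ1 hσ2 r x hr0 hr hx => ?_⟩
  have hN1 : (1 : ℝ) ≤ N := by exact_mod_cast hN
  have hN0 : (0 : ℝ) < N := by linarith
  have hσ : 0 < σ := by
    by_contra! hneg
    have : σ * (N : ℝ) ^ 2 ≤ 0 := mul_nonpos_of_nonpos_of_nonneg hneg (by positivity)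
    linarith
  have hq : (0 : ℝ) < r.den := by exact_mod_cast r.pos
  have hq1 : (1 : ℝ) ≤ r.den := by exact_mod_cast r.pos
  have hqN : (r.den : ℝ) ≤ N := by exact_mod_cast hr
  have hpi := Real.pi_gt_three
  have hpi4 := Real.pi_lt_d2
  obtain ⟨hspiA, hdiff⟩ := inv_norm_vline_sq_sub_le hN hσ hσ2 hr0 hr hx
  have hx' : |x - r| ≤ 1 / (r.den * N) := by
    refine hx.trans ?_
    gcongr 1 / (?_ * _)
    linarith
  obtain ⟨hθ, hYZ, -⟩ := h N σ hN hσ1 hσ2 r x hr hx'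
  have ha : (1 : ℝ) ≤ |(r.num : ℝ)| := by
    exact_mod_cast Int.one_le_abs (Rat.num_ne_zero.2 hr0)
  have hrabs : |(r : ℝ)| = |(r.num : ℝ)| / r.den := by
    rw [Rat.cast_def, abs_div, abs_of_pos hq]
  have harc : arcWeight k r * (‖vline σ (x - r)‖ ^ k)⁻¹ =
      (π * gaussWeight r.den / (r.den * ‖vline σ (x - r)‖)) ^ k * (1 / (2 * π * r) ^ 2) := by
    rw [arcWeight, ← div_div, div_pow _ ‖vline σ (x - r)‖]
    ring
  have hZge : σ ≤ ‖vline σ (x - r)‖ := norm_vline_ge_left _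
  rw [harc, norm_disc_sq]
  set θ := theta (vline σ x)
  have hBk := norm_volume_term_sq (vline σ x) k
  set B := ((π : ℂ) / vline σ x) ^ ((k : ℂ) / 2)
  set s := ‖vline σ x‖
  set Z := ‖vline σ (x - r)‖
  set A := |(r : ℝ)|
  set a := |(r.num : ℝ)| with hadef
  set q : ℝ := (r.den : ℝ)
  have ha2 : (r.num : ℝ) ^ 2 = a ^ 2 := by rw [hadef, sq_abs]
  rw [ha2]
  have hZ0 : 0 < Z := hσ.trans_le hZge
  have hZinv : 1 / Z ≤ 2 * N ^ 2 := by
    rw [div_le_iff₀ hZ0]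
    nlinarith [sq_nonneg (N : ℝ)]
  have hA0 : 0 < A := by rw [hrabs]; positivity
  have hsA : A ≤ s := by nlinarith
  have hs0 : 0 < s := hA0.trans_le hsA
  have hA2 : 1 / A ^ 2 = 1 / a ^ 2 * q ^ 2 := by rw [hrabs]; field_simp
  have hs2 : 1 / s ^ 2 ≤ 1 / a ^ 2 * q ^ 2 := by rw [← hA2]; gcongr
  set W := (π * gaussWeight r.den / (q * Z)) ^ k with hW
  have hgw0 := gaussWeight_nonneg r.den
  have hW0 : 0 ≤ W := by positivity
  have hWle : W ≤ (2 * π) ^ k / (q * Z) ^ k := by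
    rw [hW, div_pow]
    gcongr ?_ ^ k / _
    rw [mul_comm]
    gcongr
    exact gaussWeight_le_two _
  have hBA : ‖B‖ ^ 2 ≤ 1 / A ^ k := by
    rw [hBk, ← one_div_pow]
    gcongr ?_ ^ k
    rw [div_le_div_iff₀ hs0 hA0]
    linarith
  have hBsq : ‖B‖ ^ 2 ≤ N ^ k := by
    refine hBA.trans ?_
    rw [← one_div_pow, hrabs, one_div_div]
    gcongr
    rw [div_le_iff₀ (by positivity)]
    nlinarith
  have hY : ‖θ ^ k‖ ^ 2 = ‖θ‖ ^ (2 * k) := by rw [norm_pow, ← pow_mul, mul_comm]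
  have hcross : ‖θ ^ k‖ * ‖B‖ ≤ (C + 1) * 2 ^ (j + 1) * (N ^ (j + 1) * (Z ^ 2)⁻¹) := by
    refine (abs_le_of_sq_le_sq' ?_ (by positivity)).2
    rw [mul_pow, hY]
    exact cross_term_le hZ0 ha hq hC hZinv (by positivity) hθ (hrabs ▸ hBA)
  have hXY := abs_sq_norm_sub_sub_le (θ ^ k) B
  have hsplit : ‖θ ^ k - B‖ ^ 2 / s ^ 2 - W * (1 / (2 * π * r) ^ 2) =
      (‖θ ^ k - B‖ ^ 2 - ‖θ ^ k‖ ^ 2) * (1 / s ^ 2) + (‖θ‖ ^ (2 * k) - W) * (1 / s ^ 2) +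
        W * (1 / s ^ 2 - 1 / (2 * π * r) ^ 2) := by
    rw [hY]; ring
  have hW3 : W * (18 * Z / A ^ 3) ≤ 18 * (2 * π) ^ k * 2 ^ (j + 2) * (1 / a ^ 2) *
      (N ^ (2 * j + 4) * (1 / q ^ 2) * (Z ^ 2)⁻¹) := by
    rw [hrabs]
    exact weight_term_le hZ0 ha hq1 hZinv hWle
  rw [hsplit]
  refine (abs_add_three _ _ _).trans ?_
  rw [abs_mul, abs_mul, abs_mul, abs_of_pos (show 0 < 1 / s ^ 2 by positivity), abs_of_nonneg hW0]
  have e1 : |‖θ ^ k - B‖ ^ 2 - ‖θ ^ k‖ ^ 2| * (1 / s ^ 2) ≤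
      (N ^ k + 2 * ((C + 1) * 2 ^ (j + 1) * (N ^ (j + 1) * (Z ^ 2)⁻¹))) * (1 / a ^ 2 * q ^ 2) := by
    gcongr
    exact hXY.trans (by gcongr)
  have e2 : |‖θ‖ ^ (2 * k) - W| * (1 / s ^ 2) ≤ (C * N ^ k) * (1 / a ^ 2 * q ^ 2) := by
    gcongr
  have e3 : W * |1 / s ^ 2 - 1 / (2 * π * r) ^ 2| ≤ _ :=
    (mul_le_mul_of_nonneg_left hdiff hW0).trans hW3
  refine (add_le_add_three e1 e2 e3).trans ?_
  set α := 1 / a ^ 2 with hα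
  have hα0 : 0 ≤ α := by positivity
  set c₁ := (C + 1) * (2 : ℝ) ^ (j + 1)
  set c₂ := 18 * (2 * π) ^ k * (2 : ℝ) ^ (j + 2)
  have hc₁ : 0 ≤ c₁ := by positivity
  have hc₂ : 0 ≤ c₂ := by positivity
  have hsum : (1 + C + 2 * c₁ + c₂) * α * (N ^ k * q ^ 2 +
      (N ^ (j + 1) * q ^ 2 + N ^ (2 * j + 4) * (1 / q ^ 2)) * (Z ^ 2)⁻¹) =
      ((N ^ k + 2 * (c₁ * (N ^ (j + 1) * (Z ^ 2)⁻¹))) * (α * q ^ 2) + C * N ^ k * (α * q ^ 2) +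
        c₂ * α * (N ^ (2 * j + 4) * (1 / q ^ 2) * (Z ^ 2)⁻¹)) +
      α * ((2 * c₁ + c₂) * (N ^ k * q ^ 2) + (1 + C + c₂) * (N ^ (j + 1) * q ^ 2 * (Z ^ 2)⁻¹) +
        (1 + C + 2 * c₁) * (N ^ (2 * j + 4) * (1 / q ^ 2) * (Z ^ 2)⁻¹)) := by ring
  rw [hsum]
  exact le_add_of_nonneg_right (by positivity)

end LatticeDiscrepancy

namespace LatticeDiscrepancy
open Set MeasureTheory

/-- The arc of order `N` around the rational `r`. -/
def fareyArc (N : ℕ) (r : ℚ) : Set ℝ :=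
  if r.den ≤ N then Metric.ball (r : ℝ) (1 / (2 * r.den * N)) else ∅

theorem measurableSet_fareyArc (N : ℕ) (r : ℚ) : MeasurableSet (fareyArc N r) := by
  unfold fareyArc
  split_ifs
  exacts [measurableSet_ball, MeasurableSet.empty]

theorem mem_fareyArc {N : ℕ} {r : ℚ} {x : ℝ} :
    x ∈ fareyArc N r ↔ r.den ≤ N ∧ |x - r| < 1 / (2 * r.den * N) := by
  unfold fareyArc
  split_ifs with h <;> simp [h, Real.dist_eq]

theorem inv_den_mul_den_le {r r' : ℚ} (h : r ≠ r') :
    1 / ((r.den : ℝ) * r'.den) ≤ |(r : ℝ) - r'| := by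
  have hq : (0 : ℝ) < r.den := by exact_mod_cast r.pos
  have hq' : (0 : ℝ) < r'.den := by exact_mod_cast r'.pos
  have h1 : (r : ℝ) - r' = ((r.num * r'.den - r'.num * r.den : ℤ) : ℝ) / (r.den * r'.den) := by
    rw [Rat.cast_def, Rat.cast_def]
    push_cast
    field_simp
  have h2 : (1 : ℝ) ≤ |((r.num * r'.den - r'.num * r.den : ℤ) : ℝ)| := by
    have : (r.num * r'.den - r'.num * r.den : ℤ) ≠ 0 := by
      intro h0
      exact h (Rat.eq_iff_mul_eq_mul.2 (sub_eq_zero.1 h0))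
    exact_mod_cast Int.one_le_abs this
  rw [h1, abs_div, abs_of_pos (mul_pos hq hq')]
  gcongr

theorem pairwise_disjoint_fareyArc (N : ℕ) :
    Pairwise (Function.onFun Disjoint (fareyArc N)) := by
  intro r r' hne
  refine Set.disjoint_left.2 fun x hx hx' => ?_
  rw [mem_fareyArc] at hx hx'
  have hq : (0 : ℝ) < r.den := by exact_mod_cast r.pos
  have hq' : (0 : ℝ) < r'.den := by exact_mod_cast r'.pos
  have hqN : (r.den : ℝ) ≤ N := by exact_mod_cast hx.1
  have hqN' : (r'.den : ℝ) ≤ N := by exact_mod_cast hx'.1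
  have hN : (0 : ℝ) < N := hq.trans_le hqN
  have h1 := inv_den_mul_den_le hne
  have h2 : |(r : ℝ) - r'| < 1 / (2 * r.den * N) + 1 / (2 * r'.den * N) := by
    have : (r : ℝ) - r' = (x - r') - (x - r) := by ring
    rw [this]
    exact (abs_sub _ _).trans_lt (by linarith [hx.2, hx'.2])
  have h3 : 1 / (2 * (r.den : ℝ) * N) + 1 / (2 * r'.den * N) ≤ 1 / ((r.den : ℝ) * r'.den) := by
    rw [div_add_div _ _ (by positivity) (by positivity), div_le_div_iff₀ (by positivity)
      (by positivity)]
    have : (r.den : ℝ) + r'.den ≤ 2 * N := by linarith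
    have h4 : 0 ≤ r.den * r'.den * (2 * N : ℝ) := by positivity
    nlinarith
  linarith

theorem integral_inv_norm_vline_sq {σ : ℝ} (hσ : 0 < σ) :
    Integrable (fun x => (‖vline σ x‖ ^ 2)⁻¹) ∧ ∫ x, (‖vline σ x‖ ^ 2)⁻¹ = 1 / (2 * σ) := by
  obtain ⟨h1, h2⟩ := integral_vline_norm_pow 2 le_rfl hσ
  refine ⟨h1, ?_⟩
  rw [h2]
  norm_num

theorem inv_two_mul_le {N σ : ℝ} (hσ : 0 < σ) (hσ1 : 1 / 2 ≤ σ * N ^ 2) :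
    1 / (2 * σ) ≤ N ^ 2 := by
  rw [div_le_iff₀ (by positivity)]
  linarith

theorem integral_arc_error_le {N : ℕ} {σ : ℝ} (hN : 1 ≤ N) (hσ : 0 < σ)
    (hσ1 : 1 / 2 ≤ σ * N ^ 2) (r : ℚ) (hr : r.den ≤ N) (j : ℕ) {F : ℝ → ℝ} {c : ℝ} (hc : 0 ≤ c)
    (hF : ∀ x : ℝ, |x - r| ≤ 1 / (2 * r.den * N) → |F x| ≤ c * (N ^ (j + 5) * r.den ^ 2 +
        (N ^ (j + 1) * r.den ^ 2 + N ^ (2 * j + 4) * (1 / r.den ^ 2)) *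
          (‖vline σ (x - r)‖ ^ 2)⁻¹)) :
    |∫ x in fareyArc N r, F x| ≤ 2 * c * (N ^ (j + 5) + N ^ (2 * j + 6) * (1 / r.den ^ 2)) := by
  have hN0 : (0 : ℝ) < N := by exact_mod_cast hN
  have hq : (0 : ℝ) < r.den := by exact_mod_cast r.pos
  have hqN : (r.den : ℝ) ≤ N := by exact_mod_cast hr
  set q : ℝ := (r.den : ℝ) with hqdef
  obtain ⟨hi, hv⟩ := integral_inv_norm_vline_sq hσ
  have hi' := hi.comp_sub_right (r : ℝ)
  have hv' := integral_sub_right_eq_self (μ := volume) (fun x => (‖vline σ x‖ ^ 2)⁻¹) (r : ℝ)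
  have hvol : volume (fareyArc N r) = ENNReal.ofReal (1 / (q * N)) := by
    rw [fareyArc, if_pos hr, Real.volume_ball]
    congr 1
    rw [← hqdef]
    field_simp
  have hfin : IsFiniteMeasure (volume.restrict (fareyArc N r)) :=
    ⟨by rw [Measure.restrict_apply_univ, hvol]; exact ENNReal.ofReal_lt_top⟩
  set D : ℝ := N ^ (j + 1) * q ^ 2 + N ^ (2 * j + 4) * (1 / q ^ 2) with hD
  have hD0 : 0 ≤ D := by positivity
  have hint : Integrable (fun x => c * (N ^ (j + 5) * q ^ 2 +
      D * (‖vline σ (x - r)‖ ^ 2)⁻¹)) (volume.restrict (fareyArc N r)) :=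
    ((integrable_const _).add ((hi'.restrict).const_mul _)).const_mul _
  rw [← Real.norm_eq_abs]
  refine (norm_integral_le_of_norm_le hint ?_).trans ?_
  · refine (ae_restrict_iff' (measurableSet_fareyArc N r)).2 (.of_forall fun x hx => ?_)
    exact hF x (mem_fareyArc.1 hx).2.le
  rw [integral_const_mul, integral_add (integrable_const _) ((hi'.restrict).const_mul _),
    integral_const_mul, integral_const, Measure.real, Measure.restrict_apply_univ, hvol,
    ENNReal.toReal_ofReal (by positivity), smul_eq_mul]
  have hle : ∫ x in fareyArc N r, (‖vline σ (x - r)‖ ^ 2)⁻¹ ≤ N ^ 2 := by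
    refine (setIntegral_le_integral hi' (.of_forall fun x => by positivity)).trans ?_
    rw [hv', hv]
    exact inv_two_mul_le hσ hσ1
  have h1 : 1 / (q * N) * (N ^ (j + 5) * q ^ 2) ≤ N ^ (j + 5) := by
    have : 1 / (q * N) * (N ^ (j + 5) * q ^ 2) = N ^ (j + 4) * q := by
      field_simp
      ring
    rw [this, pow_succ (N : ℝ) (j + 4)]
    gcongr
  have h2 : D * N ^ 2 ≤ N ^ (j + 5) + N ^ (2 * j + 6) * (1 / q ^ 2) := by
    have e1 : D * N ^ 2 = N ^ (j + 3) * q ^ 2 + N ^ (2 * j + 6) * (1 / q ^ 2) := by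
      rw [hD]; ring
    rw [e1, pow_add (N : ℝ) (j + 3) 2]
    gcongr
  calc _ ≤ c * (N ^ (j + 5) + (N ^ (j + 5) + N ^ (2 * j + 6) * (1 / q ^ 2))) := by
        refine mul_le_mul_of_nonneg_left ?_ hc
        exact add_le_add ((mul_left_comm _ _ _).trans_le h1) ((integral_const_mul _ _).trans_le <|
          (mul_le_mul_of_nonneg_left hle hD0).trans h2)
    _ ≤ _ := by
      have : (0 : ℝ) ≤ c * (N ^ (2 * j + 6) * (1 / q ^ 2)) := by positivity
      linarith

theorem arc_tail_le {N : ℕ} {σ : ℝ} (hN : 1 ≤ N) (hσ : 0 < σ)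
    (hσ1 : 1 / 2 ≤ σ * N ^ 2) (r : ℚ) (hr : r.den ≤ N) (j : ℕ) :
    |arcWeight (j + 5) r * ∫ x in (fareyArc N r)ᶜ, (‖vline σ (x - r)‖ ^ (j + 5))⁻¹| ≤
      (2 * π) ^ (j + 5) * (1 / (r.num : ℝ) ^ 2) * N ^ (j + 5) := by
  have hN0 : (0 : ℝ) < N := by exact_mod_cast hN
  have hq : (0 : ℝ) < r.den := by exact_mod_cast r.pos
  have hpi := Real.pi_gt_three
  obtain ⟨hi, hv⟩ := integral_inv_norm_vline_sq hσ
  have hi' := hi.comp_sub_right (r : ℝ)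
  have hv' := integral_sub_right_eq_self (μ := volume) (fun x => (‖vline σ x‖ ^ 2)⁻¹) (r : ℝ)
  have hw := arcWeight_le (j + 5) r
  have hw0 := arcWeight_nonneg (j + 5) r
  set q : ℝ := (r.den : ℝ) with hqdef
  have hI : ‖∫ x in (fareyArc N r)ᶜ, (‖vline σ (x - r)‖ ^ (j + 5))⁻¹‖ ≤
      (q * N) ^ (j + 3) * N ^ 2 := by
    refine (norm_integral_le_of_norm_le ((hi'.restrict (s := (fareyArc N r)ᶜ)).const_mul
      ((q * N) ^ (j + 3))) ?_).trans ?_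
    · refine (ae_restrict_iff' (measurableSet_fareyArc N r).compl).2 (.of_forall fun x hx => ?_)
      have hx' : 1 / (2 * q * N) ≤ |x - r| := by
        by_contra! h
        exact hx (mem_fareyArc.2 ⟨hr, h⟩)
      have hz : 1 / (q * N) ≤ ‖vline σ (x - r)‖ := by
        refine le_trans ?_ (norm_vline_ge_right _)
        calc 1 / (q * N) = 2 * 1 * (1 / (2 * q * N)) := by field_simp
          _ ≤ 2 * π * |x - r| := by gcongr; linarith
      have hz0 : 0 < ‖vline σ (x - r)‖ := lt_of_lt_of_le (by positivity) hz
      rw [Real.norm_of_nonneg (by positivity), pow_add _ (j + 3) 2, mul_inv]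
      gcongr
      rw [← inv_pow]
      gcongr
      rw [inv_le_comm₀ hz0 (by positivity), ← one_div]
      exact hz
    · rw [integral_const_mul]
      gcongr
      refine (setIntegral_le_integral hi' (.of_forall fun x => by positivity)).trans ?_
      rw [hv', hv]
      exact inv_two_mul_le hσ hσ1
  rw [abs_mul, abs_of_nonneg hw0, ← Real.norm_eq_abs]
  calc _ ≤ ((2 * π) ^ (j + 5) * (1 / (r.num : ℝ) ^ 2) * (q ^ 2 / q ^ (j + 5))) *
        ((q * N) ^ (j + 3) * N ^ 2) := by gcongr
    _ = _ := by
      have e1 : q ^ (j + 5) = q ^ (j + 3) * q ^ 2 := by ring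
      have e2 : (N : ℝ) ^ (j + 5) = N ^ (j + 3) * N ^ 2 := by ring
      rw [mul_pow q, e1, e2]
      generalize (2 * π) ^ (j + 5) = t
      generalize hqj : q ^ (j + 3) = qj
      have : 0 < qj := hqj ▸ by positivity
      field_simp

end LatticeDiscrepancy

namespace LatticeDiscrepancy
open Set MeasureTheory

theorem setIntegral_sub_mul_integral_eq {F G : ℝ → ℝ} {s : Set ℝ} (hs : MeasurableSet s)
    (hF : Integrable F) (hG : Integrable G) (w r : ℝ) :
    (∫ x in s, F x) - w * ∫ x, G x =
      (∫ x in s, (F x - w * G (x - r))) - w * ∫ x in sᶜ, G (x - r) := by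
  have hG' : Integrable (fun x => G (x - r)) := hG.comp_sub_right r
  rw [integral_sub hF.integrableOn (hG'.integrableOn.const_mul w), integral_const_mul,
    ← integral_sub_right_eq_self (μ := volume) G r, ← integral_add_compl hs hG']
  ring

theorem norm_inv_pow_integral_le (j : ℕ) : ∃ C : ℝ, 0 < C ∧ ∀ (N : ℕ) (σ : ℝ), 0 < σ →
    1 / 2 ≤ σ * N ^ 2 → ∫ x, (‖vline σ x‖ ^ (j + 5))⁻¹ ≤ C * (N : ℝ) ^ (2 * j + 8) := by
  have e1 : ((j + 5 : ℕ) : ℝ) - 1 = ((j + 4 : ℕ) : ℝ) := by push_cast; ring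
  refine ⟨Real.Gamma ((j + 5 : ℕ) - 1) / Real.Gamma ((j + 5 : ℕ) / 2) ^ 2, ?_, ?_⟩
  · rw [e1]
    have := Real.Gamma_pos_of_pos (s := ((j + 4 : ℕ) : ℝ)) (by positivity)
    have := Real.Gamma_pos_of_pos (s := ((j + 5 : ℕ) : ℝ) / 2) (by positivity)
    positivity
  · intro N σ hσ hσ1
    have h := inv_two_mul_le hσ hσ1
    rw [(integral_vline_norm_pow (j + 5) (by omega) hσ).2, mul_div_right_comm]
    have := Real.Gamma_pos_of_pos (s := ((j + 4 : ℕ) : ℝ)) (by positivity)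
    have := Real.Gamma_pos_of_pos (s := ((j + 5 : ℕ) : ℝ) / 2) (by positivity)
    rw [e1, Real.rpow_natCast]
    refine mul_le_mul_of_nonneg_left ?_ (by positivity)
    calc (1 / (2 * σ)) ^ (j + 4) ≤ ((N : ℝ) ^ 2) ^ (j + 4) := by gcongr
      _ = _ := by rw [← pow_mul]; congr 1

theorem arc_deviation_le (j : ℕ) : ∃ C : ℝ, 0 < C ∧ ∀ (N : ℕ) (σ : ℝ), 1 ≤ N →
    1 / 2 ≤ σ * N ^ 2 → σ * N ^ 2 ≤ 2 →
    Integrable (fun x => ‖disc (j + 5) (vline σ x)‖ ^ 2) → ∀ r : ℚ, r ≠ 0 → r.den ≤ N →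
    |(∫ x in fareyArc N r, ‖disc (j + 5) (vline σ x)‖ ^ 2) -
        arcWeight (j + 5) r * ∫ x, (‖vline σ x‖ ^ (j + 5))⁻¹| ≤
      C * (1 / (r.num : ℝ) ^ 2) * (N ^ (j + 5) + N ^ (2 * j + 6) * (1 / r.den ^ 2)) := by
  obtain ⟨C, hC, h⟩ := disc_arc_sub_le j
  refine ⟨2 * C + (2 * π) ^ (j + 5), by positivity, fun N σ hN h1 h2 hI r hr hrN => ?_⟩
  have hN0 : (0 : ℝ) < N := by exact_mod_cast hN
  have hσ : 0 < σ := by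
    by_contra! h0
    nlinarith [sq_nonneg (N : ℝ)]
  rw [setIntegral_sub_mul_integral_eq (measurableSet_fareyArc N r) hI
    (integral_vline_norm_pow (j + 5) (by omega) hσ).1 _ (r : ℝ)]
  have ha := integral_arc_error_le hN hσ h1 r hrN j
    (F := fun x => ‖disc (j + 5) (vline σ x)‖ ^ 2 -
      arcWeight (j + 5) r * (‖vline σ (x - r)‖ ^ (j + 5))⁻¹)
    (c := C * (1 / (r.num : ℝ) ^ 2)) (by positivity) (fun x hx => h N σ hN h1 h2 r x hr hrN hx)
  have hb := arc_tail_le hN hσ h1 r hrN j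
  refine (abs_sub _ _).trans ((add_le_add ha hb).trans ?_)
  have : 0 ≤ (2 * π) ^ (j + 5) * (1 / (r.num : ℝ) ^ 2) * (N ^ (2 * j + 6) * (1 / r.den ^ 2)) := by
    positivity
  linarith

theorem arc_deviation_large_den_le (j : ℕ) : ∃ C : ℝ, 0 < C ∧ ∀ (N : ℕ) (σ : ℝ), 1 ≤ N →
    0 < σ → 1 / 2 ≤ σ * N ^ 2 → ∀ r : ℚ, N < r.den →
    arcWeight (j + 5) r * ∫ x, (‖vline σ x‖ ^ (j + 5))⁻¹ ≤
      C * (1 / (r.num : ℝ) ^ 2) * (N ^ (2 * j + 7) * (1 / r.den ^ 2)) := by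
  obtain ⟨C, hC, h⟩ := norm_inv_pow_integral_le j
  refine ⟨(2 * π) ^ (j + 5) * C, by positivity, fun N σ hN hσ h1 r hr => ?_⟩
  have hN0 : (0 : ℝ) < N := by exact_mod_cast hN
  have hq : (0 : ℝ) < r.den := by exact_mod_cast r.pos
  have hNq : (N : ℝ) ≤ r.den := by exact_mod_cast hr.le
  have h2 : (r.den : ℝ) ^ 2 / (r.den : ℝ) ^ (j + 5) * N ^ (2 * j + 8) ≤
      N ^ (2 * j + 7) * (1 / r.den ^ 2) := by
    have e : (r.den : ℝ) ^ 2 / (r.den : ℝ) ^ (j + 5) = 1 / r.den ^ (j + 1) * (1 / r.den ^ 2) := by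
      field_simp
      ring
    rw [e, mul_right_comm]
    refine mul_le_mul_of_nonneg_right ?_ (by positivity)
    rw [one_div_mul_eq_div, div_le_iff₀ (by positivity), pow_succ]
    gcongr
    exact hNq.trans (le_self_pow₀ (by linarith [show (1 : ℝ) ≤ N by exact_mod_cast hN]) (by omega))
  calc _ ≤ ((2 * π) ^ (j + 5) * (1 / (r.num : ℝ) ^ 2) *
        ((r.den : ℝ) ^ 2 / (r.den : ℝ) ^ (j + 5))) * (C * (N : ℝ) ^ (2 * j + 8)) := by
        refine mul_le_mul (arcWeight_le _ _) (h N σ hσ h1)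
          (integral_nonneg fun x => by positivity) (by positivity)
    _ = ((2 * π) ^ (j + 5) * C) * (1 / (r.num : ℝ) ^ 2) *
        ((r.den : ℝ) ^ 2 / (r.den : ℝ) ^ (j + 5) * N ^ (2 * j + 8)) := by ring
    _ ≤ _ := by gcongr

theorem central_arc_integral_le (j : ℕ) : ∃ C : ℝ, 0 < C ∧ ∀ (N : ℕ) (σ : ℝ), 1 ≤ N →
    1 / 2 ≤ σ * N ^ 2 → σ * N ^ 2 ≤ 2 →
    |∫ x in fareyArc N 0, ‖disc (j + 5) (vline σ x)‖ ^ 2| ≤ C * N ^ (j + 6) := by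
  obtain ⟨C, hC, h⟩ := disc_central_arc_le (j + 5) (by omega)
  refine ⟨C, hC, fun N σ hN h1 h2 => ?_⟩
  have hN0 : (0 : ℝ) < N := by exact_mod_cast hN
  have hvol : volume (fareyArc N 0) = ENNReal.ofReal (1 / N) := by
    rw [fareyArc, if_pos (by simpa using hN), Real.volume_ball]
    congr 1
    simp only [Rat.den_zero, Nat.cast_one]
    field_simp
  rw [← Real.norm_eq_abs]
  have := norm_setIntegral_le_of_norm_le_const (μ := volume) (s := fareyArc N 0)
    (f := fun x => ‖disc (j + 5) (vline σ x)‖ ^ 2) (C := C * (N : ℝ) ^ (j + 5 + 2))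
    (by rw [hvol]; exact ENNReal.ofReal_lt_top) (fun x hx => by
      rw [Real.norm_of_nonneg (by positivity)]
      refine h N σ hN h1 h2 x ?_
      have := (mem_fareyArc.1 hx).2.le
      simp only [Rat.den_zero, Nat.cast_one, Rat.cast_zero, sub_zero] at this
      refine this.trans ?_
      gcongr
      linarith)
  refine this.trans_eq ?_
  rw [Measure.real, hvol, ENNReal.toReal_ofReal (by positivity)]
  field_simp
  ring

theorem off_arcs_integral_le (j : ℕ) : ∃ C : ℝ, 0 < C ∧ ∀ (N : ℕ) (σ : ℝ), 1 ≤ N →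
    1 / 2 ≤ σ * N ^ 2 → σ * N ^ 2 ≤ 2 →
    |∫ x in (⋃ r, fareyArc N r)ᶜ, ‖disc (j + 5) (vline σ x)‖ ^ 2| ≤ C * N ^ (j + 6) := by
  obtain ⟨C, hC, h⟩ := disc_off_arcs_le (j + 5) (by omega)
  refine ⟨C, hC, fun N σ hN h1 h2 => ?_⟩
  have hN0 : (0 : ℝ) < N := by exact_mod_cast hN
  obtain ⟨hi, hv⟩ := integral_inv_norm_vline_sq (σ := 1 / (N : ℝ)) (by positivity)
  rw [← Real.norm_eq_abs]
  refine (norm_integral_le_of_norm_le ((hi.restrict (s := (⋃ r, fareyArc N r)ᶜ)).const_mul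
    (C * (N : ℝ) ^ (j + 5))) ?_).trans ?_
  · refine (ae_restrict_iff' (MeasurableSet.iUnion
      (measurableSet_fareyArc N)).compl).2 (.of_forall fun x hx => ?_)
    rw [Real.norm_of_nonneg (by positivity)]
    refine h N σ hN h1 h2 x fun r hr => ?_
    by_contra! h0
    exact hx (mem_iUnion.2 ⟨r, mem_fareyArc.2 ⟨hr, h0⟩⟩)
  · rw [integral_const_mul]
    calc _ ≤ C * (N : ℝ) ^ (j + 5) * N := by
          gcongr
          refine (setIntegral_le_integral hi (.of_forall fun x => by positivity)).trans ?_
          rw [hv]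
          field_simp
          norm_num
      _ = _ := by ring

end LatticeDiscrepancy

namespace LatticeDiscrepancy
open Set MeasureTheory

theorem tsum_le_of_le_num_mul_den {D : ℚ → ℝ} {a : ℤ → ℝ} {b : ℕ → ℝ} (ha0 : ∀ n, 0 ≤ a n)
    (hb0 : ∀ n, 0 ≤ b n) (ha : Summable a) (hb : Summable b)
    (hD : ∀ r : ℚ, |D r| ≤ a r.num * b r.den) :
    Summable D ∧ |∑' r, D r| ≤ (∑' n, a n) * ∑' n, b n := by
  have hab : Summable (fun p : ℤ × ℕ => a p.1 * b p.2) := ha.mul_of_nonneg hb ha0 hb0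
  have hinj : Function.Injective (fun r : ℚ => ((r.num, r.den) : ℤ × ℕ)) := fun r s h => by
    simp only [Prod.mk.injEq] at h
    exact Rat.ext h.1 h.2
  have hs : Summable (fun r : ℚ => a r.num * b r.den) := hab.comp_injective hinj
  have hD' : Summable (fun r => ‖D r‖) := hs.of_nonneg_of_le (fun r => abs_nonneg _) hD
  refine ⟨hD'.of_norm, ?_⟩
  rw [← Real.norm_eq_abs]
  refine (norm_tsum_le_tsum_norm hD').trans ((hD'.tsum_le_tsum hD hs).trans ?_)
  rw [ha.tsum_mul_tsum hb hab]
  exact hs.tsum_le_tsum_of_inj (fun r : ℚ => ((r.num, r.den) : ℤ × ℕ)) hinj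
    (fun p _ => mul_nonneg (ha0 _) (hb0 _)) (fun r => le_rfl) hab

/-- A majorant, in terms of the denominator, for the errors on the Farey arcs. -/
noncomputable def denBound (j N q : ℕ) : ℝ :=
  (if q ≤ N then (N : ℝ) ^ (j + 5) else 0) + N ^ (2 * j + 6) * (1 / (q : ℝ) ^ 2) +
    (if N < q then N ^ (2 * j + 7) * (1 / (q : ℝ) ^ 2) else 0)

theorem denBound_nonneg (j N q : ℕ) : 0 ≤ denBound j N q := by
  unfold denBound
  positivity

theorem sum_range_denBound_le (j : ℕ) {N : ℕ} (hN : 1 ≤ N) (n : ℕ) :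
    ∑ q ∈ Finset.range n, denBound j N q ≤ 6 * (N : ℝ) ^ (2 * j + 6) := by
  have hN0 : (0 : ℝ) < N := by exact_mod_cast hN
  have hN1 : (1 : ℝ) ≤ N := by exact_mod_cast hN
  simp only [denBound, Finset.sum_add_distrib]
  have h1 : ∑ q ∈ Finset.range n, (if q ≤ N then (N : ℝ) ^ (j + 5) else 0) ≤
      2 * (N : ℝ) ^ (2 * j + 6) := by
    rw [← Finset.sum_filter, Finset.sum_const, nsmul_eq_mul]
    have hc : ((Finset.range n).filter (· ≤ N)).card ≤ N + 1 := by
      refine (Finset.card_le_card (t := Finset.range (N + 1)) fun q hq => ?_).trans_eq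
        (Finset.card_range _)
      simp only [Finset.mem_filter, Finset.mem_range] at hq ⊢
      omega
    calc _ ≤ ((N + 1 : ℕ) : ℝ) * (N : ℝ) ^ (j + 5) := by gcongr
      _ ≤ (2 * N) * (N : ℝ) ^ (j + 5) := by
          gcongr
          push_cast
          linarith
      _ = 2 * (N : ℝ) ^ (j + 6) := by ring
      _ ≤ _ := by
          gcongr 2 * ?_
          exact pow_le_pow_right₀ hN1 (by omega)
  have h2 : ∑ q ∈ Finset.range n, (N : ℝ) ^ (2 * j + 6) * (1 / (q : ℝ) ^ 2) ≤
      (N : ℝ) ^ (2 * j + 6) * 2 := by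
    rw [← Finset.mul_sum]
    gcongr
    have := sum_Ioo_inv_sq_le (α := ℝ) 0 n
    simp only [Nat.cast_zero, zero_add, div_one] at this
    refine le_trans (le_of_eq ?_) this
    simp only [one_div]
    refine (Finset.sum_subset (fun q hq => ?_) fun q hq hq' => ?_).symm
    · simp only [Finset.mem_Ioo, Finset.mem_range] at hq ⊢
      omega
    · simp only [Finset.mem_Ioo, Finset.mem_range] at hq hq'
      obtain rfl : q = 0 := by omega
      simp
  have h3 : ∑ q ∈ Finset.range n, (if N < q then (N : ℝ) ^ (2 * j + 7) * (1 / (q : ℝ) ^ 2) else 0) ≤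
      2 * (N : ℝ) ^ (2 * j + 6) := by
    rw [← Finset.sum_filter, ← Finset.mul_sum]
    have e : (Finset.range n).filter (N < ·) = Finset.Ioo N n := by
      ext q
      simp only [Finset.mem_Ioo, Finset.mem_filter, Finset.mem_range]
      omega
    rw [e]
    have := sum_Ioo_inv_sq_le (α := ℝ) N n
    simp only [one_div]
    calc _ ≤ (N : ℝ) ^ (2 * j + 7) * (2 / (N + 1)) := by gcongr
      _ ≤ (N : ℝ) ^ (2 * j + 7) * (2 / N) := by gcongr; linarith
      _ = _ := by
          rw [pow_succ]
          field_simp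
  linarith

theorem summable_denBound (j : ℕ) {N : ℕ} (hN : 1 ≤ N) :
    Summable (denBound j N) ∧ ∑' q, denBound j N q ≤ 6 * (N : ℝ) ^ (2 * j + 6) :=
  ⟨summable_of_sum_range_le (denBound_nonneg j N) (sum_range_denBound_le j hN),
    Real.tsum_le_of_sum_range_le (denBound_nonneg j N) (sum_range_denBound_le j hN)⟩

theorem summable_arcWeight (j : ℕ) : Summable (arcWeight (j + 5)) := by
  refine (tsum_le_of_le_num_mul_den (a := fun n => (2 * π) ^ (j + 5) * (1 / (n : ℝ) ^ 2))
    (b := fun n => 1 / (n : ℝ) ^ 2) (fun n => by positivity) (fun n => by positivity)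
    ((Real.summable_one_div_int_pow.2 one_lt_two).mul_left _)
    (Real.summable_one_div_nat_pow.2 one_lt_two) fun r => ?_).1
  rw [abs_of_nonneg (arcWeight_nonneg _ _)]
  refine (arcWeight_le _ _).trans ?_
  have hq : (1 : ℝ) ≤ r.den := by exact_mod_cast r.pos
  refine mul_le_mul_of_nonneg_left ?_ (by positivity)
  rw [div_le_div_iff₀ (by positivity) (by positivity), one_mul, ← pow_add]
  exact pow_le_pow_right₀ hq (by omega)

theorem arcWeight_zero (k : ℕ) : arcWeight k 0 = 0 := by
  simp [arcWeight]

theorem arc_deviation_le_num_mul_den (j : ℕ) : ∃ C : ℝ, 0 < C ∧ ∀ (N : ℕ) (σ : ℝ), 1 ≤ N →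
    1 / 2 ≤ σ * N ^ 2 → σ * N ^ 2 ≤ 2 →
    Integrable (fun x => ‖disc (j + 5) (vline σ x)‖ ^ 2) → ∀ r : ℚ,
    |(∫ x in fareyArc N r, ‖disc (j + 5) (vline σ x)‖ ^ 2) -
        arcWeight (j + 5) r * ∫ x, (‖vline σ x‖ ^ (j + 5))⁻¹| ≤
      (C * (1 / (r.num : ℝ) ^ 2) + if r.num = 0 then C else 0) * denBound j N r.den := by
  obtain ⟨C₁, hC₁, h₁⟩ := arc_deviation_le j
  obtain ⟨C₂, hC₂, h₂⟩ := arc_deviation_large_den_le j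
  obtain ⟨C₃, hC₃, h₃⟩ := central_arc_integral_le j
  refine ⟨C₁ + C₂ + C₃, by positivity, fun N σ hN hσ1 hσ2 hI r => ?_⟩
  have hN0 : (0 : ℝ) < N := by exact_mod_cast hN
  have hN1 : (1 : ℝ) ≤ N := by exact_mod_cast hN
  have hσ : 0 < σ := by
    by_contra! h0
    nlinarith [sq_nonneg (N : ℝ)]
  rcases eq_or_ne r 0 with rfl | hr
  · rw [arcWeight_zero, zero_mul, sub_zero]
    refine (h₃ N σ hN hσ1 hσ2).trans ?_
    have : (N : ℝ) ^ (j + 6) ≤ N ^ (2 * j + 6) := pow_le_pow_right₀ hN1 (by omega)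
    have h5 : 0 ≤ (N : ℝ) ^ (j + 5) := by positivity
    have hd : denBound j N 1 = (N : ℝ) ^ (j + 5) + N ^ (2 * j + 6) := by
      simp [denBound, hN, show N ≠ 0 by omega]
    rw [Rat.num_zero, Rat.den_zero, if_pos rfl, Int.cast_zero, hd]
    norm_num
    refine mul_le_mul ?_ ?_ (by positivity) (by positivity) <;> linarith
  · rw [if_neg (by simpa using hr), add_zero]
    by_cases hq : r.den ≤ N
    · refine (h₁ N σ hN hσ1 hσ2 hI r hr hq).trans ?_
      rw [denBound, if_pos hq, if_neg (by omega), add_zero]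
      gcongr
      linarith
    · push Not at hq
      have he : fareyArc N r = ∅ := by rw [fareyArc, if_neg (by omega)]
      rw [he, setIntegral_empty, zero_sub, abs_neg, abs_of_nonneg
        (mul_nonneg (arcWeight_nonneg _ _) (integral_nonneg fun x => by positivity))]
      refine (h₂ N σ hN hσ hσ1 r hq).trans ?_
      rw [denBound, if_neg (by omega), if_pos hq, zero_add]
      have : 0 ≤ (N : ℝ) ^ (2 * j + 6) * (1 / r.den ^ 2) := by positivity
      gcongr
      · linarith
      · linarith

theorem integral_disc_sub_le (j : ℕ) : ∃ C : ℝ, 0 < C ∧ ∀ (N : ℕ) (σ : ℝ), 1 ≤ N →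
    1 / 2 ≤ σ * N ^ 2 → σ * N ^ 2 ≤ 2 →
    Integrable (fun x => ‖disc (j + 5) (vline σ x)‖ ^ 2) →
    |(∫ x, ‖disc (j + 5) (vline σ x)‖ ^ 2) -
        (∑' r, arcWeight (j + 5) r) * ∫ x, (‖vline σ x‖ ^ (j + 5))⁻¹| ≤ C * N ^ (2 * j + 6) := by
  obtain ⟨C₁, hC₁, h₁⟩ := arc_deviation_le_num_mul_den j
  obtain ⟨C₂, hC₂, h₂⟩ := off_arcs_integral_le j
  have ha : Summable (fun n : ℤ => C₁ * (1 / (n : ℝ) ^ 2) + if n = 0 then C₁ else 0) :=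
    ((Real.summable_one_div_int_pow.2 one_lt_two).mul_left _).add
      (summable_of_ne_finset_zero (s := {0}) fun n hn => if_neg (by simpa using hn))
  have ha0 : ∀ n : ℤ, 0 ≤ C₁ * (1 / (n : ℝ) ^ 2) + if n = 0 then C₁ else 0 := fun n => by
    positivity
  refine ⟨(∑' n : ℤ, (C₁ * (1 / (n : ℝ) ^ 2) + if n = 0 then C₁ else 0)) * 6 + C₂,
    add_pos_of_nonneg_of_pos (mul_nonneg (tsum_nonneg ha0) (by norm_num)) hC₂,
    fun N σ hN hσ1 hσ2 hI => ?_⟩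
  have hN1 : (1 : ℝ) ≤ N := by exact_mod_cast hN
  obtain ⟨hb, hb'⟩ := summable_denBound j hN
  obtain ⟨hD, hD'⟩ := tsum_le_of_le_num_mul_den ha0 (denBound_nonneg j N) ha hb
    (h₁ N σ hN hσ1 hσ2 hI)
  have hU := hasSum_integral_iUnion (measurableSet_fareyArc N) (pairwise_disjoint_fareyArc N)
    (hI.integrableOn (s := ⋃ r, fareyArc N r))
  rw [hU.summable.tsum_sub ((summable_arcWeight j).mul_right _), hU.tsum_eq, tsum_mul_right] at hD'
  rw [← integral_add_compl (MeasurableSet.iUnion (measurableSet_fareyArc N)) hI,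
    add_sub_right_comm]
  refine (abs_add_le _ _).trans ((add_le_add hD' (h₂ N σ hN hσ1 hσ2)).trans ?_)
  rw [add_mul, mul_assoc _ (6 : ℝ)]
  have h6 : (N : ℝ) ^ (j + 6) ≤ N ^ (2 * j + 6) := pow_le_pow_right₀ hN1 (by omega)
  exact add_le_add (mul_le_mul_of_nonneg_left hb' (tsum_nonneg ha0))
    (mul_le_mul_of_nonneg_left h6 hC₂.le)

end LatticeDiscrepancy

namespace LatticeDiscrepancy
open Set

/-- The map sending `(d, a / q)` to `(d * a, d * q)`. -/
def scaleNumDen (p : ℕ+ × ℚ) : ℤ × ℕ := ((p.1 : ℕ) * p.2.num, (p.1 : ℕ) * p.2.den)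

theorem scaleNumDen_injective : Function.Injective scaleNumDen := by
  rintro ⟨d, r⟩ ⟨d', r'⟩ h
  simp only [scaleNumDen, Prod.mk.injEq] at h
  obtain ⟨h1, h2⟩ := h
  have key : ∀ (d : ℕ+) (r : ℚ), r = (((d : ℕ) * r.num : ℤ) : ℚ) / (((d : ℕ) * r.den : ℕ) : ℚ) := by
    intro d r
    have hd : ((d : ℕ) : ℚ) ≠ 0 := by exact_mod_cast d.ne_zero
    push_cast
    rw [mul_div_mul_left _ _ hd, Rat.num_div_den]
  obtain rfl : r = r' := by rw [key d r, key d' r', h1, h2]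
  rw [Nat.mul_right_cancel_iff r.pos] at h2
  rw [PNat.coe_injective h2]

theorem mem_range_scaleNumDen {m : ℤ} {n : ℕ} (hn : n ≠ 0) : (m, n) ∈ range scaleNumDen := by
  obtain ⟨c, h1, h2⟩ := Rat.num_den_mk (n := m) (d := (n : ℤ)) (by exact_mod_cast hn) rfl
  have hc : 0 < c := by
    refine pos_of_mul_pos_left (b := ((Rat.divInt m n).den : ℤ)) ?_ (by positivity)
    rw [← h2]
    positivity
  lift c to ℕ using hc.le
  refine ⟨(⟨c, by exact_mod_cast hc⟩, Rat.divInt m n), ?_⟩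
  simp only [scaleNumDen, PNat.mk_coe, Prod.mk.injEq]
  exact ⟨h1.symm, by exact_mod_cast h2.symm⟩

theorem tsum_int_of_even {f : ℤ → ℝ} (hf : Summable f) (h0 : f 0 = 0) (he : ∀ n, f (-n) = f n) :
    ∑' n, f n = 2 * ∑' n : ℕ, f n := by
  have h1 : Summable (fun n : ℕ => f n) := hf.comp_injective Nat.cast_injective
  have := (h1.hasSum.of_nat_of_neg (f := f) (by simpa only [he] using h1.hasSum)).tsum_eq
  rw [this, h0]
  ring

theorem tsum_dvd_inv_pow (c : ℕ) (hc : c ≠ 0) (s : ℕ) :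
    ∑' n : ℕ, (if c ∣ n then 1 / (n : ℝ) ^ s else 0) =
      1 / (c : ℝ) ^ s * ∑' n : ℕ, 1 / (n : ℝ) ^ s := by
  have hinj : Function.Injective (fun n : ℕ => c * n) := fun a b h =>
    Nat.eq_of_mul_eq_mul_left (Nat.pos_of_ne_zero hc) h
  rw [← hinj.tsum_eq, ← tsum_mul_left]
  · refine tsum_congr fun n => ?_
    rw [if_pos (Dvd.intro _ rfl)]
    push_cast
    rw [mul_pow, one_div_mul_one_div]
  · intro n hn
    by_contra h
    refine hn (if_neg fun ⟨m, hm⟩ => h ⟨m, hm.symm⟩)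

theorem summable_ite_inv_pow (p : ℕ → Prop) [DecidablePred p] {s : ℕ} (hs : 2 ≤ s) :
    Summable (fun n : ℕ => if p n then 1 / (n : ℝ) ^ s else 0) := by
  refine (Real.summable_one_div_nat_pow.2 (show 1 < s by omega)).of_nonneg_of_le
    (fun n => by positivity) fun n => ?_
  split_ifs
  · exact le_rfl
  · positivity

theorem tsum_odd_inv_pow {s : ℕ} (hs : 2 ≤ s) :
    ∑' n : ℕ, (if Odd n then 1 / (n : ℝ) ^ s else 0) =
      (1 - 1 / 2 ^ s) * ∑' n : ℕ, 1 / (n : ℝ) ^ s := by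
  have h1 := tsum_dvd_inv_pow 2 two_ne_zero s
  have h2 := (summable_ite_inv_pow Odd hs).tsum_add (summable_ite_inv_pow (2 ∣ ·) hs)
  have h3 : ∀ n : ℕ, ((if Odd n then 1 / (n : ℝ) ^ s else 0) + if 2 ∣ n then 1 / (n : ℝ) ^ s else 0)
      = 1 / (n : ℝ) ^ s := by
    intro n
    rcases Nat.even_or_odd n with h | h
    · rw [if_neg (Nat.not_odd_iff_even.2 h), if_pos h.two_dvd, zero_add]
    · rw [if_pos h, if_neg (by rwa [← even_iff_two_dvd, Nat.not_even_iff_odd]), add_zero]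
  simp only [h3] at h2
  push_cast at h1
  linarith

theorem summable_ite_int (p : ℤ → Prop) [DecidablePred p] :
    Summable (fun m : ℤ => if p m then 1 / (m : ℝ) ^ 2 else 0) := by
  refine (Real.summable_one_div_int_pow.2 (show 1 < 2 by omega)).of_nonneg_of_le
    (fun n => by positivity) fun n => ?_
  split_ifs
  · exact le_rfl
  · positivity

theorem tsum_int_inv_sq : ∑' m : ℤ, 1 / (m : ℝ) ^ 2 = π ^ 2 / 3 := by
  rw [tsum_int_of_even (Real.summable_one_div_int_pow.2 one_lt_two) (by simp) (by simp)]
  have := hasSum_zeta_two.tsum_eq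
  push_cast
  rw [this]
  ring

theorem tsum_int_odd_inv_sq : ∑' m : ℤ, (if Odd m then 1 / (m : ℝ) ^ 2 else 0) = π ^ 2 / 4 := by
  rw [tsum_int_of_even (summable_ite_int Odd) (by simp) (by simp)]
  have h1 := hasSum_zeta_two.tsum_eq
  have h2 := tsum_odd_inv_pow (s := 2) le_rfl
  rw [h1] at h2
  simp only [Int.odd_coe_nat, Int.cast_natCast]
  rw [h2]
  ring

/-- The summand of the double series that factors through `scaleNumDen`. -/
noncomputable def pairWeight (j : ℕ) (p : ℤ × ℕ) : ℝ :=
  1 / (p.1 : ℝ) ^ 2 * (if Odd p.2 then 1 / (p.2 : ℝ) ^ (j + 3) else 0) +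
    2 ^ (j + 5) * ((if Odd p.1 then 1 / (p.1 : ℝ) ^ 2 else 0) *
      (if 4 ∣ p.2 then 1 / (p.2 : ℝ) ^ (j + 3) else 0))

theorem hasSum_mul_of_nonneg {ι κ : Type*} {f : ι → ℝ} {g : κ → ℝ} (hf : Summable f)
    (hg : Summable g) (hf0 : ∀ i, 0 ≤ f i) (hg0 : ∀ i, 0 ≤ g i) :
    HasSum (fun p : ι × κ => f p.1 * g p.2) ((∑' i, f i) * ∑' i, g i) :=
  hf.hasSum.mul hg.hasSum (hf.mul_of_nonneg hg hf0 hg0)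

theorem hasSum_pairWeight (j : ℕ) : HasSum (pairWeight j)
    (π ^ 2 / 3 * ((1 - 1 / 2 ^ (j + 3)) * ∑' n : ℕ, 1 / (n : ℝ) ^ (j + 3)) +
      2 ^ (j + 5) * (π ^ 2 / 4 * (1 / 4 ^ (j + 3) * ∑' n : ℕ, 1 / (n : ℝ) ^ (j + 3)))) := by
  have h1 := hasSum_mul_of_nonneg (Real.summable_one_div_int_pow.2 one_lt_two)
    (summable_ite_inv_pow Odd (s := j + 3) (by omega)) (fun n => by positivity)
    (fun n => by positivity)
  have h2 := hasSum_mul_of_nonneg (summable_ite_int Odd)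
    (summable_ite_inv_pow (4 ∣ ·) (s := j + 3) (by omega)) (fun n => by positivity)
    (fun n => by positivity)
  have h4 := tsum_dvd_inv_pow 4 four_ne_zero (j + 3)
  rw [tsum_int_inv_sq, tsum_odd_inv_pow (by omega)] at h1
  rw [tsum_int_odd_inv_sq, h4, Nat.cast_ofNat] at h2
  exact h1.add (h2.mul_left (2 ^ (j + 5)))

theorem pairWeight_scaleNumDen (j : ℕ) (d : ℕ+) (r : ℚ) :
    pairWeight j (scaleNumDen (d, r)) =
      (if Odd (d : ℕ) then 1 / ((d : ℕ) : ℝ) ^ (j + 5) else 0) *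
        (gaussWeight r.den ^ (j + 5) / (r.den : ℝ) ^ (j + 3) * (1 / (r.num : ℝ) ^ 2)) := by
  have hd : ((d : ℕ) : ℝ) ≠ 0 := by exact_mod_cast d.ne_zero
  have hq : (r.den : ℝ) ≠ 0 := by exact_mod_cast r.den_ne_zero
  simp only [pairWeight, scaleNumDen, Int.odd_mul, Nat.odd_mul, Int.odd_coe_nat, gaussWeight]
  have e : (1 : ℝ) / (d : ℕ) ^ (j + 5) = 1 / (d : ℕ) ^ 2 * (1 / (d : ℕ) ^ (j + 3)) := by
    rw [one_div_mul_one_div, ← pow_add]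
    congr 2
    ring
  have e1 : 1 / (((d : ℕ) * r.num : ℤ) : ℝ) ^ 2 = 1 / (d : ℕ) ^ 2 * (1 / (r.num : ℝ) ^ 2) := by
    push_cast
    rw [mul_pow, one_div_mul_one_div]
  have e2 : 1 / (((d : ℕ) * r.den : ℕ) : ℝ) ^ (j + 3) =
      1 / (d : ℕ) ^ (j + 3) * (1 / (r.den : ℝ) ^ (j + 3)) := by
    push_cast
    rw [mul_pow, one_div_mul_one_div]
  rw [e1, e2, e]
  by_cases hdo : Odd (d : ℕ)
  · have h4 : 4 ∣ (d : ℕ) * r.den ↔ 4 ∣ r.den := by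
      refine Nat.Coprime.dvd_mul_left ?_
      exact Nat.Coprime.pow_left 2 (Nat.coprime_two_left.2 hdo)
    simp only [hdo, true_and, if_true, h4]
    by_cases hqo : Odd r.den
    · have h5 : ¬ 4 ∣ r.den := fun h =>
        (Nat.not_even_iff_odd.2 hqo) (even_iff_two_dvd.2 (dvd_trans (by norm_num) h))
      simp only [hqo, h5, if_true, if_false, one_pow]
      ring
    · by_cases h5 : 4 ∣ r.den
      · have hn : Odd r.num := by
          by_contra h
          rw [Int.not_odd_iff_even, even_iff_two_dvd] at h
          have h6 : 2 ∣ r.num.natAbs := Int.natCast_dvd.1 h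
          have h7 : 2 ∣ r.den := dvd_trans (by norm_num) h5
          have := Nat.dvd_gcd h6 h7
          rw [r.reduced] at this
          norm_num at this
        simp only [hqo, h5, hn, if_true, if_false]
        ring
      · simp only [hqo, h5, if_false]
        simp
  · simp [hdo]

theorem tsum_arcWeight_mul (j : ℕ) :
    ((1 - 1 / 2 ^ (j + 5)) * ∑' n : ℕ, 1 / (n : ℝ) ^ (j + 5)) * ∑' r, arcWeight (j + 5) r =
      π ^ (j + 5) / 12 * (1 + 8 / 2 ^ (j + 5)) * ∑' n : ℕ, 1 / (n : ℝ) ^ (j + 3) := by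
  have hw : ∀ r : ℚ, arcWeight (j + 5) r = π ^ (j + 3) / 4 *
      (gaussWeight r.den ^ (j + 5) / (r.den : ℝ) ^ (j + 3) * (1 / (r.num : ℝ) ^ 2)) := by
    intro r
    have hq : (r.den : ℝ) ≠ 0 := by exact_mod_cast r.den_ne_zero
    rcases eq_or_ne r 0 with rfl | hr
    · simp [arcWeight]
    have hn : (r.num : ℝ) ≠ 0 := by exact_mod_cast Rat.num_ne_zero.2 hr
    have hpi := Real.pi_ne_zero
    have hrc : (r : ℝ) = r.num / r.den := Rat.cast_def r
    rw [arcWeight, hrc, div_pow, mul_pow, pow_add π (j + 3) 2, pow_add (r.den : ℝ) (j + 3) 2]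
    field_simp
    ring
  have h1 : ∑' p : ℕ+ × ℚ, pairWeight j (scaleNumDen p) = ∑' p, pairWeight j p := by
    refine scaleNumDen_injective.tsum_eq fun p hp => ?_
    refine mem_range_scaleNumDen fun h0 => hp ?_
    simp [pairWeight, h0]
  have sG : Summable fun r : ℚ =>
      gaussWeight r.den ^ (j + 5) / (r.den : ℝ) ^ (j + 3) * (1 / (r.num : ℝ) ^ 2) := by
    have := summable_arcWeight j
    rw [funext hw] at this
    exact (summable_mul_left_iff (by positivity)).1 this
  have sd0 := summable_ite_inv_pow Odd (s := j + 5) (by omega)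
  have sd : Summable fun d : ℕ+ => if Odd (d : ℕ) then 1 / ((d : ℕ) : ℝ) ^ (j + 5) else 0 :=
    sd0.comp_injective PNat.coe_injective
  have h2 : ∑' d : ℕ+, (if Odd (d : ℕ) then 1 / ((d : ℕ) : ℝ) ^ (j + 5) else 0) =
      (1 - 1 / 2 ^ (j + 5)) * ∑' n : ℕ, 1 / (n : ℝ) ^ (j + 5) := by
    rw [← tsum_odd_inv_pow (by omega)]
    refine PNat.coe_injective.tsum_eq (f := fun n : ℕ => if Odd n then 1 / (n : ℝ) ^ (j + 5) else 0)
      fun n hn => ?_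
    refine ⟨⟨n, Nat.pos_of_ne_zero fun h => hn ?_⟩, rfl⟩
    simp [h]
  have h3 := sd.tsum_mul_tsum sG (sd.mul_of_nonneg sG (fun d => by positivity) fun r => by
    have := gaussWeight_nonneg r.den
    positivity)
  simp only [← pairWeight_scaleNumDen] at h3
  rw [h2, h1, (hasSum_pairWeight j).tsum_eq] at h3
  simp only [hw]
  rw [tsum_mul_left, mul_left_comm, h3]
  have e4 : (4 : ℝ) ^ (j + 3) = 2 ^ (j + 3) * 2 ^ (j + 3) := by
    rw [← mul_pow]; norm_num
  rw [e4, pow_add (2 : ℝ) (j + 3) 2, pow_add π (j + 3) 2]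
  field_simp
  ring

end LatticeDiscrepancy

namespace LatticeDiscrepancy
open Set MeasureTheory

theorem rzeta_natCast {s : ℕ} (hs : 1 < s) : rzeta s = ∑' n : ℕ, 1 / (n : ℝ) ^ s := by
  have h : (∑' n : ℕ, 1 / (n : ℂ) ^ s) = ((∑' n : ℕ, 1 / (n : ℝ) ^ s : ℝ) : ℂ) := by
    push_cast
    rfl
  rw [rzeta, Complex.ofReal_natCast, zeta_nat_eq_tsum_of_gt_one hs, h, Complex.ofReal_re]

theorem rzeta_natCast_pos {s : ℕ} (hs : 1 < s) : 0 < rzeta s := by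
  rw [rzeta_natCast hs]
  have := (Real.summable_one_div_nat_pow.2 hs).le_tsum 1 fun n _ => by positivity
  simp only [Nat.cast_one, one_pow, div_one] at this
  linarith

theorem tsum_arcWeight (j : ℕ) : ∑' r, arcWeight (j + 5) r =
    π ^ (j + 5) * rzeta (j + 3 : ℕ) * (1 + 8 / 2 ^ (j + 5)) /
      (12 * ((1 - 1 / 2 ^ (j + 5)) * rzeta (j + 5 : ℕ))) := by
  have h := tsum_arcWeight_mul j
  rw [← rzeta_natCast (by omega), ← rzeta_natCast (by omega)] at h
  have h1 := rzeta_natCast_pos (s := j + 5) (by omega)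
  have h2 : (0 : ℝ) < 1 - 1 / 2 ^ (j + 5) := by
    rw [sub_pos, div_lt_one (by positivity)]
    exact one_lt_pow₀ one_lt_two (by omega)
  rw [eq_div_iff (by positivity)]
  linarith

theorem Ck_sub_eq (j : ℕ) :
    Ck (j + 5) - π ^ ((j + 5 : ℕ) : ℝ) / (6 * Real.Gamma (((j + 5 : ℕ) : ℝ) / 2) ^ 2) =
      (∑' r, arcWeight (j + 5) r) / Real.Gamma (((j + 5 : ℕ) : ℝ) / 2) ^ 2 := by
  have hk : (0 : ℝ) < ((j + 5 : ℕ) : ℝ) / 2 := by positivity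
  have hG := (Real.Gamma_pos_of_pos hk).ne'
  have hV : Vk (j + 5) ^ 2 = π ^ (j + 5) /
      (((j + 5 : ℕ) : ℝ) / 2 * Real.Gamma (((j + 5 : ℕ) : ℝ) / 2)) ^ 2 := by
    rw [Vk, Real.Gamma_add_one hk.ne', div_pow, ← Real.rpow_natCast (π ^ (_ : ℝ)) 2,
      ← Real.rpow_mul Real.pi_pos.le]
    rw [show ((j + 5 : ℕ) : ℝ) / 2 * ((2 : ℕ) : ℝ) = ((j + 5 : ℕ) : ℝ) by push_cast; ring,
      Real.rpow_natCast]
  have e3 : ((j + 5 : ℕ) : ℝ) - 2 = ((j + 3 : ℕ) : ℝ) := by push_cast; ring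
  have e4 : (2 : ℝ) ^ ((3 : ℝ) - ((j + 5 : ℕ) : ℝ)) = 8 / 2 ^ (j + 5) := by
    rw [Real.rpow_sub two_pos, Real.rpow_natCast, show (3 : ℝ) = ((3 : ℕ) : ℝ) by norm_num,
      Real.rpow_natCast]
    norm_num
  have e5 : (2 : ℝ) ^ (-((j + 5 : ℕ) : ℝ)) = 1 / 2 ^ (j + 5) := by
    rw [Real.rpow_neg two_pos.le, Real.rpow_natCast, one_div]
  rw [Ck, hV, tsum_arcWeight, e3, e4, rzeta2, e5, Real.rpow_natCast]
  generalize Real.Gamma (((j + 5 : ℕ) : ℝ) / 2) = g at *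
  generalize (1 - 1 / 2 ^ (j + 5)) * rzeta (j + 5 : ℕ) = z
  have hk' : ((j + 5 : ℕ) : ℝ) ≠ 0 := by positivity
  generalize ((j + 5 : ℕ) : ℝ) = k at *
  generalize π ^ (j + 5) = p
  have : k ^ 2 / 24 * (p / (k / 2 * g) ^ 2) = p / (6 * g ^ 2) := by
    field_simp
    ring
  rw [this, add_sub_cancel_left, div_div]
  congr 1
  ring

theorem exists_nat_sq_approx {X : ℝ} (hX : 1 ≤ X) :
    ∃ N : ℕ, 1 ≤ N ∧ X ≤ (N : ℝ) ^ 2 ∧ (N : ℝ) ^ 2 ≤ 4 * X := by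
  have h1 : 1 ≤ √X := Real.one_le_sqrt.2 hX
  have h2 := Nat.le_ceil √X
  have h3 := Nat.ceil_lt_add_one (Real.sqrt_nonneg X)
  have h4 := Real.sq_sqrt (zero_le_one.trans hX)
  refine ⟨⌈√X⌉₊, Nat.one_le_ceil_iff.2 (by linarith), ?_, ?_⟩
  · exact h4.ge.trans (by gcongr)
  · calc (⌈√X⌉₊ : ℝ) ^ 2 ≤ (2 * √X) ^ 2 := by
          gcongr
          linarith
      _ = 4 * X := by
          rw [mul_pow, h4]
          norm_num

theorem laplace_discrepancy_sub_le (j : ℕ) : ∃ A : ℝ, 0 < A ∧ ∀ X : ℝ, 2 ≤ X →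
    IntegrableOn (fun t : ℝ => Pk (j + 5) t ^ 2 * Real.exp (-t / X)) (Ioi 0) ∧
    |(∫ t in Ioi (0 : ℝ), Pk (j + 5) t ^ 2 * Real.exp (-t / X)) -
      (∑' r, arcWeight (j + 5) r) / Real.Gamma (((j + 5 : ℕ) : ℝ) / 2) ^ 2 *
        Real.Gamma (((j + 5 : ℕ) : ℝ) - 1) * X ^ (((j + 5 : ℕ) : ℝ) - 1)| ≤ A * X ^ (j + 3) := by
  obtain ⟨C, hC, h⟩ := integral_disc_sub_le j
  refine ⟨C * 4 ^ (j + 3), by positivity, fun X hX => ?_⟩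
  have hX0 : 0 < X := by linarith
  obtain ⟨h1, h2, h3⟩ := disc_mean_square (j + 5) (by omega) hX0
  refine ⟨h1, ?_⟩
  obtain ⟨N, hN, hN1, hN2⟩ := exists_nat_sq_approx (X := X) (by linarith)
  have hE := h N (1 / (2 * X)) hN
    (by rw [one_div_mul_eq_div, le_div_iff₀ (by positivity)]; linarith)
    (by rw [one_div_mul_eq_div, div_le_iff₀ (by positivity)]; linarith) h2
  rw [h3, (integral_vline_norm_pow (j + 5) (by omega) (by positivity)).2,
    show 1 / (2 * (1 / (2 * X))) = X by field_simp] at hE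
  have e : (∑' r, arcWeight (j + 5) r) / Real.Gamma (((j + 5 : ℕ) : ℝ) / 2) ^ 2 *
        Real.Gamma (((j + 5 : ℕ) : ℝ) - 1) * X ^ (((j + 5 : ℕ) : ℝ) - 1) =
      (∑' r, arcWeight (j + 5) r) * (Real.Gamma (((j + 5 : ℕ) : ℝ) - 1) *
        X ^ (((j + 5 : ℕ) : ℝ) - 1) / Real.Gamma (((j + 5 : ℕ) : ℝ) / 2) ^ 2) := by ring
  rw [e]
  refine hE.trans ?_
  calc C * (N : ℝ) ^ (2 * j + 6) = C * ((N : ℝ) ^ 2) ^ (j + 3) := by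
        rw [← pow_mul]
        congr 2
    _ ≤ C * (4 * X) ^ (j + 3) := by gcongr
    _ = _ := by rw [mul_pow, mul_assoc]

end LatticeDiscrepancy

/-- Laplace transform of the squared discrepancy, `k ≥ 5`. -/
theorem laplace_transform_high_dim (k : ℕ) (hk : 5 ≤ k) :
    ∀ ε : ℝ, 0 < ε → ∃ A : ℝ, 0 < A ∧ ∀ X : ℝ, 2 ≤ X →
      MeasureTheory.IntegrableOn (fun t : ℝ => Pk k t ^ 2 * Real.exp (-t / X))
        (Set.Ioi 0) ∧
      |(∫ t in Set.Ioi (0 : ℝ), Pk k t ^ 2 * Real.exp (-t / X))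
          - (Ck k - Real.pi ^ (k : ℝ) / (6 * (Real.Gamma ((k : ℝ) / 2)) ^ 2))
              * Real.Gamma ((k : ℝ) - 1) * X ^ ((k : ℝ) - 1)|
        ≤ A * X ^ ((k : ℝ) - 2 + ε) := by
  intro ε hε
  obtain ⟨j, rfl⟩ := Nat.exists_eq_add_of_le' hk
  obtain ⟨A, hA, h⟩ := LatticeDiscrepancy.laplace_discrepancy_sub_le j
  refine ⟨A, hA, fun X hX => ⟨(h X hX).1, ?_⟩⟩
  rw [LatticeDiscrepancy.Ck_sub_eq]
  refine (h X hX).2.trans (mul_le_mul_of_nonneg_left ?_ hA.le)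
  rw [← Real.rpow_natCast]
  refine Real.rpow_le_rpow_of_exponent_le (by linarith) ?_
  push_cast
  linarith
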